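/- arXiv:2102.05887 — 2 statements merged into one kernel-verified Lean document; each statement's English description precedes it below -/
import Mathlib

section
/- Let d ≥ 2 and let Ω ⊂ ℝ^d be an open, bounded, uniformly convex set. Let f be a finite signed Borel measure on ∂Ω with f(∂Ω) = 0 which decomposes as f = f_ac + f_at, where f_ac is absolutely continuous with respect to the (d−1)-dimensional Hausdorff measure restricted to ∂Ω and f_at is atomic (a countable sum of point masses). Let γ be any optimal transport plan between the positive part f⁺ and the negative part f⁻ of the Jordan decomposition of f. Then the transport density decomposes as σ_γ = σ_ac + σ_at, where σ_ac is absolutely continuous with respect to the Lebesgue measure on ℝ^d and σ_at is concentrated on a countable union of closed line segments (in particular, on a set of Hausdorff dimension at most one). -/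
open MeasureTheory Set Metric Filter
open scoped ENNReal NNReal Topology

noncomputable section

/-- A transport plan between the measures `μ` and `ν`: a positive measure on the product
whose first marginal is `μ` and whose second marginal is `ν`. -/
def IsTransportPlan {α : Type*} [MeasurableSpace α] (μ ν : Measure α)
    (γ : Measure (α × α)) : Prop :=
  γ.map Prod.fst = μ ∧ γ.map Prod.snd = ν

/-- The transport cost of a plan `γ` for the distance cost `c(x,y) = |x - y|`. -/
def transportCost {α : Type*} [MeasurableSpace α] [PseudoEMetricSpace α]
    (γ : Measure (α × α)) : ℝ≥0∞ :=
  ∫⁻ p, edist p.1 p.2 ∂γ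

/-- `γ` is an optimal transport plan between `μ` and `ν` for the cost `|x - y|`. -/
def IsOptimalPlan {α : Type*} [MeasurableSpace α] [PseudoEMetricSpace α] (μ ν : Measure α)
    (γ : Measure (α × α)) : Prop :=
  IsTransportPlan μ ν γ ∧
    ∀ γ' : Measure (α × α), IsTransportPlan μ ν γ' → transportCost γ ≤ transportCost γ'

/-- The transport density of a plan `γ`, as a set function:
`σ_γ(A) = ∫ ℋ¹([x,y] ∩ A) dγ(x,y)`. -/
def transportDensity {d : ℕ}
    (γ : Measure (EuclideanSpace ℝ (Fin d) × EuclideanSpace ℝ (Fin d)))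
    (A : Set (EuclideanSpace ℝ (Fin d))) : ℝ≥0∞ :=
  ∫⁻ p, μH[1] (segment ℝ p.1 p.2 ∩ A) ∂γ

/-- An open bounded set `Ω` is uniformly convex if it is convex and there is `R > 0` such
that for every boundary point `x` there is a unit vector `n` with `Ω ⊆ B(x + Rn, R)`. -/
def UniformlyConvexSet {d : ℕ} (Ω : Set (EuclideanSpace ℝ (Fin d))) : Prop :=
  Convex ℝ Ω ∧ ∃ R > (0 : ℝ), ∀ x ∈ frontier Ω, ∃ n : EuclideanSpace ℝ (Fin d),
    ‖n‖ = 1 ∧ Ω ⊆ Metric.ball (x + R • n) R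

/-- The (topological) support of a measure: the points all of whose neighbourhoods have
positive measure.  For finite Borel measures on a second-countable space this is the smallest
closed set of full measure. -/
def msupport {α : Type*} [TopologicalSpace α] [MeasurableSpace α] (μ : Measure α) : Set α :=
  {x | ∀ U ∈ nhds x, μ U ≠ 0}

/-- Almost every pair of rays of an optimal plan of finite cost is monotone: otherwise exchanging
the targets of the non-monotone pairs would lower the cost. -/
lemma ae_monotone_of_isOptimalPlan {α : Type*} [MeasurableSpace α] [PseudoEMetricSpace α]
    [OpensMeasurableSpace α] [SecondCountableTopology α]
    {μ ν : Measure α} {γ : Measure (α × α)} [IsFiniteMeasure γ]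
    (hγ : IsOptimalPlan μ ν γ) (hfin : transportCost γ ≠ ∞) :
    ∀ᵐ q ∂(γ.prod γ), edist q.1.1 q.1.2 + edist q.2.1 q.2.2 ≤
      edist q.1.1 q.2.2 + edist q.2.1 q.1.2 := by
  classical
  rcases eq_or_ne γ 0 with rfl | hγ0
  · simp
  let m := γ univ
  have hm0 : m ≠ 0 := by simpa [m] using hγ0
  have hmt : m ≠ ∞ := measure_ne_top _ _
  let B : Set ((α × α) × (α × α)) := {q | edist q.1.1 q.2.2 + edist q.2.1 q.1.2 <
    edist q.1.1 q.1.2 + edist q.2.1 q.2.2}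
  have hB : MeasurableSet B := measurableSet_lt (by fun_prop) (by fun_prop)
  let T₁ : (α × α) × (α × α) → α × α := B.piecewise (fun q => (q.1.1, q.2.2)) (fun q => q.1)
  let T₂ : (α × α) × (α × α) → α × α := B.piecewise (fun q => (q.2.1, q.1.2)) (fun q => q.2)
  have hT₁ : Measurable T₁ := Measurable.piecewise hB (by fun_prop) (by fun_prop)
  have hT₂ : Measurable T₂ := Measurable.piecewise hB (by fun_prop) (by fun_prop)
  let π := γ.prod γ
  let c : ℝ≥0∞ := (m + m)⁻¹
  have hc0 : c ≠ 0 := by simp [c, hmt]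
  have hct : c ≠ ∞ := by simp [c, hm0]
  have hcm : c * (m + m) = 1 := ENNReal.inv_mul_cancel (by simp [hm0]) (by simp [hmt])
  have key : ∀ g : α × α → ℝ≥0∞, Measurable g →
      ∫⁻ q, (g q.1 + g q.2) ∂π = (m + m) * ∫⁻ p, g p ∂γ := by
    intro g hg
    rw [lintegral_add_left (by fun_prop)]
    have h1 : ∫⁻ q, g q.1 ∂π = m * ∫⁻ p, g p ∂γ := by
      rw [← lintegral_map (g := Prod.fst) hg measurable_fst]
      change ∫⁻ p, g p ∂(π.map Prod.fst) = _
      rw [Measure.map_fst_prod, lintegral_smul_measure, smul_eq_mul]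
    have h2 : ∫⁻ q, g q.2 ∂π = m * ∫⁻ p, g p ∂γ := by
      rw [← lintegral_map (g := Prod.snd) hg measurable_snd]
      change ∫⁻ p, g p ∂(π.map Prod.snd) = _
      rw [Measure.map_snd_prod, lintegral_smul_measure, smul_eq_mul]
    rw [h1, h2, add_mul]
  let γ' := c • (π.map T₁ + π.map T₂)
  have key' : ∀ g : α × α → ℝ≥0∞, Measurable g →
      ∫⁻ p, g p ∂γ' = c * ∫⁻ q, (g (T₁ q) + g (T₂ q)) ∂π := by
    intro g hg
    rw [lintegral_smul_measure, lintegral_add_measure, lintegral_map hg hT₁,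
      lintegral_map hg hT₂, smul_eq_mul,
      lintegral_add_left (f := fun q => g (T₁ q)) (hg.comp hT₁)]
  have marg : ∀ (pr : α × α → α), Measurable pr →
      (∀ (h : α → ℝ≥0∞) q, h (pr (T₁ q)) + h (pr (T₂ q)) = h (pr q.1) + h (pr q.2)) →
      γ'.map pr = γ.map pr := by
    intro pr hpr hsym
    ext s hs
    have hg : Measurable fun p => s.indicator (1 : α → ℝ≥0∞) (pr p) :=
      (measurable_one.indicator hs).comp hpr
    have hval : ∀ ρ : Measure (α × α), ρ.map pr s = ∫⁻ p, s.indicator 1 (pr p) ∂ρ := by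
      intro ρ
      rw [← lintegral_map (f := s.indicator (1 : α → ℝ≥0∞)) (measurable_one.indicator hs) hpr,
        lintegral_indicator_one hs]
    rw [hval, hval, key' _ hg]
    simp_rw [hsym]
    rw [key _ hg, ← mul_assoc, hcm, one_mul]
  have hplan : IsTransportPlan μ ν γ' := by
    refine ⟨?_, ?_⟩
    · rw [← hγ.1.1]
      refine marg _ measurable_fst fun h q => ?_
      by_cases hq : q ∈ B <;> simp [T₁, T₂, hq]
    · rw [← hγ.1.2]
      refine marg _ measurable_snd fun h q => ?_
      by_cases hq : q ∈ B <;> simp [T₁, T₂, hq, add_comm]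
  have hopt := hγ.2 γ' hplan
  let e : α × α → ℝ≥0∞ := fun p => edist p.1 p.2
  have he : Measurable e := by fun_prop
  have hcost : transportCost γ' = c * ∫⁻ q, (e (T₁ q) + e (T₂ q)) ∂π := key' e he
  have hcost0 : transportCost γ = c * ∫⁻ q, (e q.1 + e q.2) ∂π := by
    rw [key e he, ← mul_assoc, hcm, one_mul]; rfl
  have hle : ∀ q, e (T₁ q) + e (T₂ q) ≤ e q.1 + e q.2 := by
    intro q
    by_cases hq : q ∈ B
    · simpa [T₁, T₂, hq, e] using le_of_lt hq
    · simp [T₁, T₂, hq]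
  have hint : ∫⁻ q, (e q.1 + e q.2) ∂π ≤ ∫⁻ q, (e (T₁ q) + e (T₂ q)) ∂π := by
    rw [hcost, hcost0] at hopt
    exact (ENNReal.mul_le_mul_iff_right hc0 hct).1 hopt
  have hfin' : ∫⁻ q, (e (T₁ q) + e (T₂ q)) ∂π ≠ ∞ := by
    refine ne_top_of_le_ne_top ?_ (lintegral_mono hle)
    rw [key e he]
    exact ENNReal.mul_ne_top (by simp [hmt]) hfin
  have hae := ae_eq_of_ae_le_of_lintegral_le (ae_of_all _ hle) hfin'
    (by fun_prop) hint
  filter_upwards [hae] with q hq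
  by_contra! hlt
  have hqB : q ∈ B := hlt
  simp only [T₁, T₂, Set.piecewise_eq_of_mem _ _ _ hqB, e] at hq
  exact absurd hq hlt.ne

/-- The support of an optimal plan of finite cost is monotone. -/
lemma monotone_support_of_isOptimalPlan {α : Type*} [MeasurableSpace α] [PseudoMetricSpace α]
    [OpensMeasurableSpace α] [SecondCountableTopology α]
    {μ ν : Measure α} {γ : Measure (α × α)} [IsFiniteMeasure γ]
    (hγ : IsOptimalPlan μ ν γ) (hfin : transportCost γ ≠ ∞)
    {p p' : α × α} (hp : p ∈ γ.support) (hp' : p' ∈ γ.support) :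
    dist p.1 p.2 + dist p'.1 p'.2 ≤ dist p.1 p'.2 + dist p'.1 p.2 := by
  by_contra! hlt
  let B : Set ((α × α) × (α × α)) := {q | dist q.1.1 q.2.2 + dist q.2.1 q.1.2 <
    dist q.1.1 q.1.2 + dist q.2.1 q.2.2}
  have hB : IsOpen B := isOpen_lt (by fun_prop) (by fun_prop)
  have h0 : (γ.prod γ) B = 0 := by
    refine measure_mono_null (fun q hq => ?_)
      (ae_iff.1 (ae_monotone_of_isOptimalPlan hγ hfin))
    change ¬ _ ≤ _
    rw [not_le]
    simp only [edist_dist]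
    rw [← ENNReal.ofReal_add (by positivity) (by positivity),
      ← ENNReal.ofReal_add (by positivity) (by positivity)]
    exact (ENNReal.ofReal_lt_ofReal_iff_of_nonneg (by positivity)).2 hq
  obtain ⟨U, hU, V, hV, hUV⟩ := mem_nhds_prod_iff.1 (hB.mem_nhds (show (p, p') ∈ B from hlt))
  have h1 := (Measure.mem_support_iff_forall p).1 hp U hU
  have h2 := (Measure.mem_support_iff_forall p').1 hp' V hV
  have := measure_mono_null hUV h0
  rw [Measure.prod_prod, mul_eq_zero] at this
  rcases this with h | h
  · exact h1.ne' h
  · exact h2.ne' h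

/-- The transport density of a plan as a measure. -/
def transportDensityMeasure {E : Type*} [NormedAddCommGroup E] [NormedSpace ℝ E]
    [MeasurableSpace E] (γ : Measure (E × E)) : Measure E :=
  ((γ.withDensity fun p => edist p.1 p.2).prod (volume.restrict (Icc (0 : ℝ) 1))).map
    fun q => AffineMap.lineMap q.1.1 q.1.2 q.2

lemma hausdorffMeasure_segment_inter {E : Type*} [NormedAddCommGroup E] [NormedSpace ℝ E]
    [MeasurableSpace E] [BorelSpace E] (x y : E) (A : Set E) :
    μH[1] (segment ℝ x y ∩ A) =
      edist x y * volume (Icc (0 : ℝ) 1 ∩ AffineMap.lineMap x y ⁻¹' A) := by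
  rw [segment_eq_image_lineMap, ← image_inter_preimage, hausdorffMeasure_lineMap_image,
    hausdorffMeasure_real, edist_nndist]
  rfl

lemma transportDensityMeasure_apply {d : ℕ}
    (γ : Measure (EuclideanSpace ℝ (Fin d) × EuclideanSpace ℝ (Fin d))) [IsFiniteMeasure γ]
    {A : Set (EuclideanSpace ℝ (Fin d))} (hA : MeasurableSet A) :
    transportDensityMeasure γ A = transportDensity γ A := by
  have hm : Measurable fun q : (EuclideanSpace ℝ (Fin d) × EuclideanSpace ℝ (Fin d)) × ℝ =>
      AffineMap.lineMap q.1.1 q.1.2 q.2 := by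
    simp only [AffineMap.lineMap_apply]
    fun_prop
  have hed : Measurable fun p : EuclideanSpace ℝ (Fin d) × EuclideanSpace ℝ (Fin d) =>
      edist p.1 p.2 := by fun_prop
  rw [transportDensityMeasure, Measure.map_apply hm hA, Measure.prod_apply (hm hA),
    lintegral_withDensity_eq_lintegral_mul _ hed (measurable_measure_prodMk_left (hm hA))]
  refine lintegral_congr fun p => ?_
  rw [hausdorffMeasure_segment_inter, Pi.mul_apply, Measure.restrict_apply
    (measurable_prodMk_left (hm hA)), inter_comm]
  rfl

lemma openSegment_subset_of_uniformlyConvexSet {d : ℕ} {Ω : Set (EuclideanSpace ℝ (Fin d))}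
    (hΩo : IsOpen Ω) (hΩ : UniformlyConvexSet Ω) {x y : EuclideanSpace ℝ (Fin d)}
    (hx : x ∈ closure Ω) (hy : y ∈ closure Ω) (hxy : x ≠ y) : openSegment ℝ x y ⊆ Ω := by
  obtain ⟨hconv, R, hR, hball⟩ := hΩ
  intro z hz
  by_contra hzΩ
  have hzc : z ∈ closure Ω := hconv.closure.openSegment_subset hx hy hz
  have hzf : z ∈ frontier Ω := by rw [hΩo.frontier_eq]; exact ⟨hzc, hzΩ⟩
  obtain ⟨n, hn, hsub⟩ := hball z hzf
  have hcl : closure Ω ⊆ closedBall (z + R • n) R :=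
    (closure_mono hsub).trans closure_ball_subset_closedBall
  have := (strictConvex_closedBall ℝ (z + R • n) R).openSegment_subset (hcl hx) (hcl hy) hxy hz
  rw [interior_closedBall _ hR.ne', mem_ball, dist_eq_norm] at this
  simp [norm_smul, hn, abs_of_pos hR] at this

lemma hausdorffMeasure_image_eq_zero_of_dist_le {ι X Y : Type*} [MetricSpace X] [MeasurableSpace X]
    [BorelSpace X] [MetricSpace Y] [MeasurableSpace Y] [BorelSpace Y] {Φ : ι → X} {Ψ : ι → Y}
    {S : Set ι} {K s : ℝ} (hs : 0 ≤ s)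
    (h : ∀ a ∈ S, ∀ b ∈ S, dist (Ψ a) (Ψ b) ≤ K * dist (Φ a) (Φ b))
    (h0 : μH[s] (Φ '' S) = 0) : μH[s] (Ψ '' S) = 0 := by
  rcases S.eq_empty_or_nonempty with rfl | ⟨a₀, ha₀⟩
  · simp
  have : Nonempty ι := ⟨a₀⟩
  let g : X → Y := fun x => Ψ (Function.invFunOn Φ S x)
  have hmem : ∀ a ∈ S, Function.invFunOn Φ S (Φ a) ∈ S := fun a ha =>
    Function.invFunOn_mem ⟨a, ha, rfl⟩
  have heq : ∀ a ∈ S, Φ (Function.invFunOn Φ S (Φ a)) = Φ a := fun a ha =>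
    Function.invFunOn_eq ⟨a, ha, rfl⟩
  have hg : LipschitzOnWith K.toNNReal g (Φ '' S) := by
    refine LipschitzOnWith.of_dist_le_mul ?_
    rintro _ ⟨a, ha, rfl⟩ _ ⟨b, hb, rfl⟩
    have := h _ (hmem a ha) _ (hmem b hb)
    rw [heq a ha, heq b hb] at this
    exact this.trans (mul_le_mul_of_nonneg_right (Real.le_coe_toNNReal K) dist_nonneg)
  have himg : g '' (Φ '' S) = Ψ '' S := by
    rw [image_image]
    refine image_congr fun a ha => ?_
    have := h _ (hmem a ha) a ha
    rw [heq a ha, dist_self, mul_zero] at this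
    exact dist_le_zero.1 this
  rw [← himg]
  refine le_antisymm ((hg.hausdorffMeasure_image_le hs).trans ?_) zero_le
  rw [h0, mul_zero]

section Rays

variable {E : Type*} [NormedAddCommGroup E] [InnerProductSpace ℝ E]

/-- Directions of rays of a monotone set are Lipschitz away from the endpoints. -/
lemma direction_lipschitz {x x' e e' : E} {l l' a a' r : ℝ} (he : ‖e‖ = 1) (he' : ‖e'‖ = 1)
    (hr : 0 ≤ r) (h1 : r ≤ a) (h2 : a ≤ l - r) (h1' : r ≤ a') (h2' : a' ≤ l' - r)
    (hmono : l + l' ≤ dist x (x' + l' • e') + dist x' (x + l • e)) :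
    r * ‖e - e'‖ ≤ ‖(x + a • e) - (x' + a' • e')‖ := by
  set δ := (x + a • e) - (x' + a' • e') with hδ
  have hA : dist x (x' + l' • e') ≤ (a - r) + ‖r • (e + e') - δ‖ + (l' - a' - r) := by
    rw [dist_comm, dist_eq_norm]
    calc ‖x' + l' • e' - x‖ = ‖(a - r) • e + (r • (e + e') - δ) + (l' - a' - r) • e'‖ := by
          congr 1; rw [hδ]; module
      _ ≤ ‖(a - r) • e‖ + ‖r • (e + e') - δ‖ + ‖(l' - a' - r) • e'‖ := norm_add₃_le
      _ = _ := by
          rw [norm_smul, norm_smul, he, he', Real.norm_of_nonneg (by linarith),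
            Real.norm_of_nonneg (by linarith), mul_one, mul_one]
  have hB : dist x' (x + l • e) ≤ (a' - r) + ‖r • (e + e') + δ‖ + (l - a - r) := by
    rw [dist_comm, dist_eq_norm]
    calc ‖x + l • e - x'‖ = ‖(a' - r) • e' + (r • (e + e') + δ) + (l - a - r) • e‖ := by
          congr 1; rw [hδ]; module
      _ ≤ ‖(a' - r) • e'‖ + ‖r • (e + e') + δ‖ + ‖(l - a - r) • e‖ := norm_add₃_le
      _ = _ := by
          rw [norm_smul, norm_smul, he, he', Real.norm_of_nonneg (by linarith),
            Real.norm_of_nonneg (by linarith), mul_one, mul_one]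
  have hsum : 4 * r ≤ ‖r • (e + e') + δ‖ + ‖r • (e + e') - δ‖ := by linarith
  have hpar := parallelogram_law_with_norm ℝ (r • (e + e')) δ
  have hpar' := parallelogram_law_with_norm ℝ e e'
  rw [norm_smul, Real.norm_of_nonneg hr] at hpar
  rw [he, he'] at hpar'
  refine le_of_sq_le_sq ?_ (norm_nonneg _)
  nlinarith [sq_nonneg (‖r • (e + e') + δ‖ - ‖r • (e + e') - δ‖),
    mul_self_le_mul_self (by positivity) hsum, mul_nonneg hr hr]

lemma norm_add_smul_sub_le {z z' e e' : E} {τ τ' L r : ℝ} (he : ‖e‖ = 1) (hr : 0 < r)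
    (hL : |τ'| ≤ L) (hd : r * ‖e - e'‖ ≤ ‖z - z'‖)
    (hτ : r * |τ - τ'| ≤ ‖z - z'‖ + L * ‖e - e'‖) :
    ‖(z + τ • e) - (z' + τ' • e')‖ ≤ (1 + (1 + L / r) / r + L / r) * ‖z - z'‖ := by
  have hL0 : 0 ≤ L := (abs_nonneg _).trans hL
  have hd' : ‖e - e'‖ ≤ ‖z - z'‖ / r := by rw [le_div_iff₀ hr]; linarith
  have hτ' : |τ - τ'| ≤ (‖z - z'‖ + L * (‖z - z'‖ / r)) / r := by
    rw [le_div_iff₀ hr]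
    nlinarith [mul_le_mul_of_nonneg_left hd' hL0]
  calc ‖(z + τ • e) - (z' + τ' • e')‖ = ‖(z - z') + (τ - τ') • e + τ' • (e - e')‖ := by
        congr 1; module
    _ ≤ ‖z - z'‖ + ‖(τ - τ') • e‖ + ‖τ' • (e - e')‖ := norm_add₃_le
    _ = ‖z - z'‖ + |τ - τ'| + |τ'| * ‖e - e'‖ := by
        rw [norm_smul, norm_smul, he, mul_one, Real.norm_eq_abs, Real.norm_eq_abs]
    _ ≤ ‖z - z'‖ + (‖z - z'‖ + L * (‖z - z'‖ / r)) / r + L * (‖z - z'‖ / r) := by gcongr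
    _ = _ := by ring

/-- Exit times from a convex set depend in a Lipschitz way on the starting point and direction. -/
lemma exit_time_sub_le {Ω : Set E} (hΩ : Convex ℝ Ω) (hΩo : IsOpen Ω) {h h' e e' : E}
    {τ τ' L r : ℝ} (hr : 0 < r) (hL0 : 0 ≤ L) (hτ' : 0 < τ') (hτL : τ ≤ L)
    (hball : ball h r ⊆ Ω) (hx : h - τ • e ∈ closure Ω) (hx' : h' - τ' • e' ∉ Ω) :
    r * (τ - τ') ≤ L * (‖h - h'‖ + L * ‖e - e'‖) := by
  rcases le_or_gt τ τ' with hle | hlt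
  · have : 0 ≤ L * (‖h - h'‖ + L * ‖e - e'‖) := by positivity
    nlinarith
  have hτ : 0 < τ := hτ'.trans hlt
  have hL : 0 < L := hτ.trans_le hτL
  by_contra! hcon
  refine hx' ?_
  set s := τ' / τ with hs
  have hs1 : s < 1 := (div_lt_one hτ).2 hlt
  have hs0 : 0 < s := div_pos hτ' hτ
  have hsτ : s * τ = τ' := div_mul_cancel₀ _ hτ.ne'
  set w := (h' - τ' • e') - (h - τ' • e) with hw
  have hwn : ‖w‖ ≤ ‖h - h'‖ + τ' * ‖e - e'‖ := by
    calc ‖w‖ = ‖(h' - h) + τ' • (e - e')‖ := by congr 1; rw [hw]; module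
      _ ≤ ‖h' - h‖ + ‖τ' • (e - e')‖ := norm_add_le _ _
      _ = _ := by rw [norm_sub_rev, norm_smul, Real.norm_of_nonneg hτ'.le]
  have hwr : ‖w‖ < (1 - s) * r := by
    have h1 : ‖w‖ ≤ ‖h - h'‖ + L * ‖e - e'‖ := hwn.trans (by gcongr; linarith)
    have h2 : L * ‖w‖ < r * (τ - τ') := (mul_le_mul_of_nonneg_left h1 hL.le).trans_lt hcon
    have h3 : τ - τ' = τ * (1 - s) := by rw [← hsτ]; ring
    have h4 : r * (τ * (1 - s)) ≤ r * (L * (1 - s)) := by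
      have : 0 ≤ 1 - s := by linarith
      gcongr
    rw [h3] at h2
    have : L * ‖w‖ < L * ((1 - s) * r) := by linarith
    exact lt_of_mul_lt_mul_left this hL.le
  have h1s : 0 < 1 - s := by linarith
  have hy : h + (1 - s)⁻¹ • w ∈ Ω := by
    apply hball
    rw [mem_ball, dist_eq_norm, add_sub_cancel_left, norm_smul, norm_inv,
      Real.norm_of_nonneg h1s.le, inv_mul_lt_iff₀ h1s]
    exact hwr
  have hcomb := hΩ.openSegment_interior_closure_subset_interior (x := h + (1 - s)⁻¹ • w)
    (y := h - τ • e) (by rwa [hΩo.interior_eq]) hx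
  rw [hΩo.interior_eq] at hcomb
  refine hcomb ⟨1 - s, s, h1s, hs0, by ring, ?_⟩
  rw [smul_add, smul_smul, mul_inv_cancel₀ h1s.ne', one_smul, smul_sub, smul_smul, hsτ, hw]
  module

end Rays

/-- The unit direction of the ray from `p.1` to `p.2`. -/
def rayDir {E : Type*} [NormedAddCommGroup E] [NormedSpace ℝ E] (p : E × E) : E :=
  ‖p.2 - p.1‖⁻¹ • (p.2 - p.1)

lemma norm_rayDir {E : Type*} [NormedAddCommGroup E] [NormedSpace ℝ E] {p : E × E}
    (hp : p.1 ≠ p.2) : ‖rayDir p‖ = 1 := by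
  have : ‖p.2 - p.1‖ ≠ 0 := norm_ne_zero_iff.2 (sub_ne_zero.2 hp.symm)
  rw [rayDir, norm_smul, norm_inv, norm_norm, inv_mul_cancel₀ this]

lemma dist_smul_rayDir {E : Type*} [NormedAddCommGroup E] [NormedSpace ℝ E] (p : E × E) :
    dist p.1 p.2 • rayDir p = p.2 - p.1 := by
  rcases eq_or_ne p.1 p.2 with h | h
  · simp [h]
  have : ‖p.2 - p.1‖ ≠ 0 := norm_ne_zero_iff.2 (sub_ne_zero.2 h.symm)
  rw [rayDir, dist_comm, dist_eq_norm, smul_smul, mul_inv_cancel₀ this, one_smul]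

section Cross

variable {n : ℕ}

/-- The arclength at which the ray of `p` crosses the hyperplane `{z | z i = q}`. -/
def crossTime (i : Fin (n + 1)) (q : ℝ)
    (p : EuclideanSpace ℝ (Fin (n + 1)) × EuclideanSpace ℝ (Fin (n + 1))) : ℝ :=
  (q - p.1 i) / rayDir p i

/-- The point at which the ray of `p` crosses the hyperplane `{z | z i = q}`. -/
def crossPoint (i : Fin (n + 1)) (q : ℝ)
    (p : EuclideanSpace ℝ (Fin (n + 1)) × EuclideanSpace ℝ (Fin (n + 1))) :
    EuclideanSpace ℝ (Fin (n + 1)) :=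
  p.1 + crossTime i q p • rayDir p

/-- The ray of `p` crosses the hyperplane `{z | z i = q}` transversally, far from its endpoints
and well inside `Ω`, with margin `r`. -/
def CrossesWithMargin (Ω : Set (EuclideanSpace ℝ (Fin (n + 1)))) (i : Fin (n + 1)) (q r : ℝ)
    (p : EuclideanSpace ℝ (Fin (n + 1)) × EuclideanSpace ℝ (Fin (n + 1))) : Prop :=
  p.1 ≠ p.2 ∧ r ≤ |rayDir p i| ∧ r ≤ crossTime i q p ∧ crossTime i q p ≤ dist p.1 p.2 - r ∧
    ball (crossPoint i q p) r ⊆ Ω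

/-- Points lying on a ray of `p` at distance at least `r` from the endpoints. -/
def rayCore (r : ℝ) (p : EuclideanSpace ℝ (Fin (n + 1)) × EuclideanSpace ℝ (Fin (n + 1))) :
    Set (EuclideanSpace ℝ (Fin (n + 1))) :=
  (fun a : ℝ => p.1 + a • rayDir p) '' Icc r (dist p.1 p.2 - r)

variable {Ω : Set (EuclideanSpace ℝ (Fin (n + 1)))}
  {Γ : Set (EuclideanSpace ℝ (Fin (n + 1)) × EuclideanSpace ℝ (Fin (n + 1)))}
  {i : Fin (n + 1)} {q r L : ℝ}
  {p p' : EuclideanSpace ℝ (Fin (n + 1)) × EuclideanSpace ℝ (Fin (n + 1))}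

lemma CrossesWithMargin.rayDir_ne_zero (hr : 0 < r) (hp : CrossesWithMargin Ω i q r p) :
    rayDir p i ≠ 0 := abs_pos.1 (hr.trans_le hp.2.1)

lemma CrossesWithMargin.crossPoint_apply (hr : 0 < r) (hp : CrossesWithMargin Ω i q r p) :
    crossPoint i q p i = q := by
  simp [crossPoint, crossTime, div_mul_cancel₀ _ (hp.rayDir_ne_zero hr)]

lemma rayDir_dist_le (hr : 0 < r)
    (hmono : dist p.1 p.2 + dist p'.1 p'.2 ≤ dist p.1 p'.2 + dist p'.1 p.2)
    (hp : p.1 ≠ p.2) (hp' : p'.1 ≠ p'.2) {a a' : ℝ}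
    (ha : a ∈ Icc r (dist p.1 p.2 - r)) (ha' : a' ∈ Icc r (dist p'.1 p'.2 - r)) :
    r * ‖rayDir p - rayDir p'‖ ≤ ‖(p.1 + a • rayDir p) - (p'.1 + a' • rayDir p')‖ := by
  refine direction_lipschitz (norm_rayDir hp) (norm_rayDir hp') hr.le ha.1 ha.2 ha'.1 ha'.2 ?_
  rwa [dist_smul_rayDir, dist_smul_rayDir, add_sub_cancel, add_sub_cancel]

lemma crossPoint_dist_le (hr : 0 < r)
    (hmono : dist p.1 p.2 + dist p'.1 p'.2 ≤ dist p.1 p'.2 + dist p'.1 p.2)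
    (hL' : dist p'.1 p'.2 ≤ L)
    (hp : CrossesWithMargin Ω i q r p) (hp' : CrossesWithMargin Ω i q r p') {a a' : ℝ}
    (ha : a ∈ Icc r (dist p.1 p.2 - r)) (ha' : a' ∈ Icc r (dist p'.1 p'.2 - r)) :
    ‖crossPoint i q p - crossPoint i q p'‖ ≤ (1 + (1 + L / r) / r + L / r) *
      ‖(p.1 + a • rayDir p) - (p'.1 + a' • rayDir p')‖ := by
  have hd := rayDir_dist_le hr hmono hp.1 hp'.1 ha ha'
  have hpt : ∀ (p : EuclideanSpace ℝ (Fin (n + 1)) × EuclideanSpace ℝ (Fin (n + 1))) (a : ℝ),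
      crossPoint i q p = (p.1 + a • rayDir p) + (crossTime i q p - a) • rayDir p := by
    intro p a; rw [crossPoint]; module
  have hτ'L : |crossTime i q p' - a'| ≤ L := by
    rw [abs_le]
    have h1 := ha'.1
    have h2 := ha'.2
    have h3 := hp'.2.2.1
    have h4 := hp'.2.2.2.1
    constructor <;> linarith
  rw [hpt p a, hpt p' a']
  refine norm_add_smul_sub_le (norm_rayDir hp.1) hr hτ'L hd ?_
  set z := p.1 + a • rayDir p with hz
  set z' := p'.1 + a' • rayDir p' with hz'
  set τ := crossTime i q p - a with hτ
  set τ' := crossTime i q p' - a' with hτ'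
  have hq : z i + τ * rayDir p i = q := by
    rw [← hp.crossPoint_apply hr, hpt p a]; simp [hz, hτ]
  have hq' : z' i + τ' * rayDir p' i = q := by
    rw [← hp'.crossPoint_apply hr, hpt p' a']; simp [hz', hτ']
  have hid : rayDir p i * (τ - τ') = -((z - z') i) - τ' * ((rayDir p - rayDir p') i) := by
    simp only [PiLp.sub_apply]; linear_combination hq - hq'
  have habs : |rayDir p i| * |τ - τ'| ≤ ‖z - z'‖ + L * ‖rayDir p - rayDir p'‖ := by
    rw [← abs_mul, hid]
    refine (abs_sub _ _).trans ?_
    rw [abs_neg, abs_mul]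
    gcongr
    · exact PiLp.norm_apply_le (z - z') i
    · exact dist_nonneg.trans hL'
    · exact PiLp.norm_apply_le (rayDir p - rayDir p') i
  exact (mul_le_mul_of_nonneg_right hp.2.1 (abs_nonneg _)).trans habs

lemma fst_dist_le (hΩ : Convex ℝ Ω) (hΩo : IsOpen Ω) (hr : 0 < r)
    (hmono : dist p.1 p.2 + dist p'.1 p'.2 ≤ dist p.1 p'.2 + dist p'.1 p.2)
    (hL : dist p.1 p.2 ≤ L) (hL' : dist p'.1 p'.2 ≤ L)
    (hf : p.1 ∈ frontier Ω) (hf' : p'.1 ∈ frontier Ω)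
    (hp : CrossesWithMargin Ω i q r p) (hp' : CrossesWithMargin Ω i q r p') :
    ‖p.1 - p'.1‖ ≤ (1 + (1 + L / (r / (L + 1))) / (r / (L + 1)) + L / (r / (L + 1))) *
      ‖crossPoint i q p - crossPoint i q p'‖ := by
  have hL0 : 0 ≤ L := dist_nonneg.trans hL
  rw [hΩo.frontier_eq] at hf hf'
  have hd : r * ‖rayDir p - rayDir p'‖ ≤ ‖crossPoint i q p - crossPoint i q p'‖ :=
    rayDir_dist_le hr hmono hp.1 hp'.1 ⟨hp.2.2.1, hp.2.2.2.1⟩ ⟨hp'.2.2.1, hp'.2.2.2.1⟩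
  set h := crossPoint i q p with hh
  set h' := crossPoint i q p' with hh'
  set τ := crossTime i q p with hτ
  set τ' := crossTime i q p' with hτ'
  have hx : p.1 = h - τ • rayDir p := by rw [hh, crossPoint, add_sub_cancel_right]
  have hx' : p'.1 = h' - τ' • rayDir p' := by rw [hh', crossPoint, add_sub_cancel_right]
  have hτ0 : 0 < τ := hr.trans_le hp.2.2.1
  have hτ0' : 0 < τ' := hr.trans_le hp'.2.2.1
  have hτL : τ ≤ L := by linarith [hp.2.2.2.1]
  have hτL' : τ' ≤ L := by linarith [hp'.2.2.2.1]
  have e1 := exit_time_sub_le hΩ hΩo hr hL0 hτ0' hτL hp.2.2.2.2 (hx ▸ hf.1) (hx' ▸ hf'.2)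
  have e2 := exit_time_sub_le hΩ hΩo hr hL0 hτ0 hτL' hp'.2.2.2.2 (hx' ▸ hf'.1) (hx ▸ hf.2)
  rw [norm_sub_rev h', norm_sub_rev (rayDir p')] at e2
  have habs : r * |τ - τ'| ≤ L * (‖h - h'‖ + L * ‖rayDir p - rayDir p'‖) := by
    rcases abs_cases (τ - τ') with ⟨h1, _⟩ | ⟨h1, _⟩ <;> rw [h1]
    · exact e1
    · rw [neg_sub]; exact e2
  have hLp : 0 < L + 1 := by linarith
  rw [hx, hx', sub_eq_add_neg h, sub_eq_add_neg h', ← neg_smul, ← neg_smul]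
  refine norm_add_smul_sub_le (norm_rayDir hp.1) (div_pos hr hLp) (by rwa [abs_neg, abs_of_pos hτ0'])
    ?_ ?_
  · refine le_trans ?_ hd
    gcongr
    exact div_le_self hr.le (by linarith)
  · rw [show -τ - -τ' = -(τ - τ') by ring, abs_neg, div_mul_eq_mul_div, div_le_iff₀ hLp]
    have : 0 ≤ ‖h - h'‖ + L * ‖rayDir p - rayDir p'‖ := by positivity
    nlinarith

/-- Sets of rays meeting a null set in positive length, with uniform margins, have null sets of
starting points. -/
lemma hausdorffMeasure_fst_image_of_margin (hΩ : Convex ℝ Ω) (hΩo : IsOpen Ω) (hr : 0 < r)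
    (hmono : ∀ p ∈ Γ, ∀ p' ∈ Γ,
      dist p.1 p.2 + dist p'.1 p'.2 ≤ dist p.1 p'.2 + dist p'.1 p.2)
    (hL : ∀ p ∈ Γ, dist p.1 p.2 ≤ L) (hf : ∀ p ∈ Γ, p.1 ∈ frontier Ω)
    {A : Set (EuclideanSpace ℝ (Fin (n + 1)))} (hA : volume A = 0) :
    μH[(n : ℝ)] (Prod.fst '' {p ∈ Γ | CrossesWithMargin Ω i q r p ∧
      μH[1] (rayCore r p ∩ A) ≠ 0}) = 0 := by
  have hcardn : μH[((n + 1 : ℕ) : ℝ)] = (volume : Measure (Fin (n + 1) → ℝ)) := by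
    simpa using hausdorffMeasure_pi_real (ι := Fin (n + 1))
  have hcard : μH[(n : ℝ)] = (volume : Measure (Fin n → ℝ)) := by
    simpa using hausdorffMeasure_pi_real (ι := Fin n)
  let pt : (EuclideanSpace ℝ (Fin (n + 1)) × EuclideanSpace ℝ (Fin (n + 1))) × ℝ →
      EuclideanSpace ℝ (Fin (n + 1)) := fun s => s.1.1 + s.2 • rayDir s.1
  let S := {s : (EuclideanSpace ℝ (Fin (n + 1)) × EuclideanSpace ℝ (Fin (n + 1))) × ℝ |
    s.1 ∈ Γ ∧ CrossesWithMargin Ω i q r s.1 ∧ s.2 ∈ Icc r (dist s.1.1 s.1.2 - r) ∧ pt s ∈ A}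
  let base : EuclideanSpace ℝ (Fin (n + 1)) × EuclideanSpace ℝ (Fin (n + 1)) → (Fin n → ℝ) :=
    fun p => i.removeNth (crossPoint i q p).ofLp
  let Ψ : (EuclideanSpace ℝ (Fin (n + 1)) × EuclideanSpace ℝ (Fin (n + 1))) × ℝ →
      (Fin (n + 1) → ℝ) := fun s => i.insertNth (pt s i) (base s.1)
  have hAH : μH[((n + 1 : ℕ) : ℝ)] (pt '' S) = 0 := by
    have h1 : μH[((n + 1 : ℕ) : ℝ)] ((fun z : EuclideanSpace ℝ (Fin (n + 1)) => z.ofLp) '' A)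
        = 0 := by
      rw [hcardn]
      have := (EuclideanSpace.volume_preserving_symm_measurableEquiv_toLp
        (Fin (n + 1))).symm.measure_preimage_equiv A
      rw [hA] at this
      refine measure_mono_null ?_ this
      rintro _ ⟨z, hz, rfl⟩
      exact hz
    have h2 : μH[((n + 1 : ℕ) : ℝ)] A = 0 := by
      have := hausdorffMeasure_image_eq_zero_of_dist_le (S := A) (Ψ := id)
        (K := ((Fintype.card (Fin (n + 1)) : ℝ≥0) ^ (1 / (2 : ℝ≥0∞)).toReal : ℝ≥0))
        (by positivity) (fun a _ b _ =>
          (PiLp.antilipschitzWith_ofLp 2 fun _ : Fin (n + 1) => ℝ).le_mul_dist a b) h1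
      simpa using this
    refine measure_mono_null ?_ h2
    rintro _ ⟨s, hs, rfl⟩
    exact hs.2.2.2
  set K := 1 + (1 + L / r) / r + L / r
  have hW : volume (Ψ '' S) = 0 := by
    rw [← hcardn]
    refine hausdorffMeasure_image_eq_zero_of_dist_le (K := max K 1) (by positivity) ?_ hAH
    intro s hs s' hs'
    have hbase := crossPoint_dist_le hr (hmono _ hs.1 _ hs'.1) (hL _ hs'.1) hs.2.1 hs'.2.1
      hs.2.2.1 hs'.2.2.1
    rw [dist_pi_le_iff (by positivity)]
    intro j
    rcases Fin.eq_self_or_eq_succAbove i j with rfl | ⟨k, rfl⟩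
    · simp only [Ψ, Fin.insertNth_apply_same]
      calc dist (pt s j) (pt s' j) ≤ 1 * dist (pt s) (pt s') := by
            rw [one_mul, dist_eq_norm, dist_eq_norm]
            exact PiLp.norm_apply_le (pt s - pt s') j
        _ ≤ _ := by gcongr; exact le_max_right _ _
    · simp only [Ψ, Fin.insertNth_apply_succAbove]
      calc dist (base s.1 k) (base s'.1 k) ≤ K * dist (pt s) (pt s') := by
            rw [dist_eq_norm, dist_eq_norm]
            exact (PiLp.norm_apply_le (crossPoint i q s.1 - crossPoint i q s'.1) _).trans hbase
        _ ≤ _ := by gcongr; exact le_max_left _ _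
  have hslice : ∀ᵐ v : Fin n → ℝ, volume {t : ℝ | i.insertNth t v ∈ Ψ '' S} = 0 := by
    have h1 := (volume_preserving_piFinSuccAbove (fun _ : Fin (n + 1) => ℝ)
      i).symm.measure_preimage_equiv (Ψ '' S)
    rw [hW] at h1
    have h2 := (Measure.measurePreserving_swap (μ := (volume : Measure (Fin n → ℝ)))
      (ν := (volume : Measure ℝ))).measure_preimage (NullMeasurableSet.of_null h1)
    exact Measure.measure_ae_null_of_prod_null (h2.trans h1)
  rw [ae_iff, ← hcard] at hslice
  set B := {p ∈ Γ | CrossesWithMargin Ω i q r p ∧ μH[1] (rayCore r p ∩ A) ≠ 0}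
  have hbaseB : μH[(n : ℝ)] (base '' B) = 0 := by
    refine measure_mono_null ?_ hslice
    rintro _ ⟨p, ⟨hpΓ, hpc, hpA⟩, rfl⟩
    intro h0
    refine hpA ?_
    let T : Set ℝ := {a | a ∈ Icc r (dist p.1 p.2 - r) ∧ pt (p, a) ∈ A}
    have hT : rayCore r p ∩ A ⊆ (fun a => pt (p, a)) '' T := by
      rintro _ ⟨⟨a, ha, rfl⟩, haA⟩
      exact ⟨a, ⟨ha, haA⟩, rfl⟩
    refine measure_mono_null hT (hausdorffMeasure_image_eq_zero_of_dist_le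
      (Φ := fun a => pt (p, a) i) (K := 1 / r) zero_le_one ?_ ?_)
    · intro a _ b _
      have h1 : dist (pt (p, a)) (pt (p, b)) = |a - b| := by
        rw [dist_eq_norm, show pt (p, a) - pt (p, b) = (a - b) • rayDir p by
          simp only [pt]; module, norm_smul, norm_rayDir hpc.1, mul_one, Real.norm_eq_abs]
      have h2 : dist (pt (p, a) i) (pt (p, b) i) = |a - b| * |rayDir p i| := by
        rw [Real.dist_eq, ← abs_mul]
        congr 1
        simp only [pt, PiLp.add_apply, PiLp.smul_apply, smul_eq_mul]; ring
      rw [h1, h2, one_div, le_inv_mul_iff₀ hr]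
      nlinarith [hpc.2.1, abs_nonneg (a - b)]
    · rw [hausdorffMeasure_real]
      refine measure_mono_null ?_ h0
      rintro _ ⟨a, ⟨ha, haA⟩, rfl⟩
      exact ⟨(p, a), ⟨hpΓ, hpc, ha, haA⟩, rfl⟩
  refine hausdorffMeasure_image_eq_zero_of_dist_le (Φ := base)
    (K := (1 + (1 + L / (r / (L + 1))) / (r / (L + 1)) + L / (r / (L + 1))) *
      ((Fintype.card (Fin (n + 1)) : ℝ≥0) ^ (1 / (2 : ℝ≥0∞)).toReal : ℝ≥0)) (by positivity) ?_
    hbaseB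
  intro p hp p' hp'
  have h1 := fst_dist_le hΩ hΩo hr (hmono _ hp.1 _ hp'.1) (hL _ hp.1) (hL _ hp'.1) (hf _ hp.1)
    (hf _ hp'.1) hp.2.1 hp'.2.1
  have hL0 : 0 ≤ L := dist_nonneg.trans (hL _ hp.1)
  rw [dist_eq_norm, mul_assoc]
  refine h1.trans ?_
  gcongr
  rw [← dist_eq_norm]
  refine ((PiLp.antilipschitzWith_ofLp 2 fun _ : Fin (n + 1) => ℝ).le_mul_dist _ _).trans ?_
  gcongr
  rw [dist_pi_le_iff dist_nonneg]
  intro j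
  rcases Fin.eq_self_or_eq_succAbove i j with rfl | ⟨k, rfl⟩
  · rw [hp.2.1.crossPoint_apply hr, hp'.2.1.crossPoint_apply hr, dist_self]
    exact dist_nonneg
  · exact dist_le_pi_dist (base p) (base p') k

/-- The starting points of the rays of a monotone set, joining boundary points, which meet a null
set in positive length form a null set for the surface measure. -/
lemma hausdorffMeasure_fst_image_of_null (hΩ : Convex ℝ Ω) (hΩo : IsOpen Ω)
    (hΩb : Bornology.IsBounded Ω)
    (hseg : ∀ x ∈ frontier Ω, ∀ y ∈ frontier Ω, x ≠ y → openSegment ℝ x y ⊆ Ω)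
    (hf : Γ ⊆ frontier Ω ×ˢ frontier Ω)
    (hmono : ∀ p ∈ Γ, ∀ p' ∈ Γ,
      dist p.1 p.2 + dist p'.1 p'.2 ≤ dist p.1 p'.2 + dist p'.1 p.2)
    {A : Set (EuclideanSpace ℝ (Fin (n + 1)))} (hA : volume A = 0) :
    μH[(n : ℝ)] (Prod.fst '' {p ∈ Γ | μH[1] (segment ℝ p.1 p.2 ∩ A) ≠ 0}) = 0 := by
  have hFb : Bornology.IsBounded (frontier Ω) := hΩb.closure.subset frontier_subset_closure
  have hbound : ∀ p ∈ Γ, dist p.1 p.2 ≤ diam (frontier Ω) := fun p hp =>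
    dist_le_diam_of_mem hFb (hf hp).1 (hf hp).2
  have hcover : {p ∈ Γ | μH[1] (segment ℝ p.1 p.2 ∩ A) ≠ 0} ⊆
      ⋃ (i : Fin (n + 1)) (q : ℚ) (m : ℕ), {p ∈ Γ | CrossesWithMargin Ω i q (1 / ((m : ℝ) + 1)) p ∧
        μH[1] (rayCore (1 / ((m : ℝ) + 1)) p ∩ A) ≠ 0} := by
    rintro p ⟨hpΓ, hpA⟩
    have : NullSingletonClass (μH[1] : Measure (EuclideanSpace ℝ (Fin (n + 1)))) :=
      Measure.nullSingletonClass_hausdorff _ one_pos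
    have hne : p.1 ≠ p.2 := by
      intro h
      refine hpA (measure_mono_null inter_subset_left ?_)
      rw [h, segment_same]
      exact measure_singleton _
    set l := dist p.1 p.2 with hl
    have hl0 : 0 < l := dist_pos.2 hne
    have hline : ∀ a : ℝ, p.1 + a • rayDir p = AffineMap.lineMap p.1 p.2 (a / l) := by
      intro a
      rw [AffineMap.lineMap_apply, vsub_eq_sub, vadd_eq_add, ← dist_smul_rayDir, smul_smul,
        ← hl, div_mul_cancel₀ _ hl0.ne']
      exact add_comm _ _
    obtain ⟨i, hi⟩ : ∃ i, rayDir p i ≠ 0 := by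
      by_contra! h
      have h0 : rayDir p = 0 := by ext i; exact h i
      have := norm_rayDir hne
      rw [h0, norm_zero] at this
      exact zero_ne_one this
    obtain ⟨q, hq0, hql⟩ : ∃ q : ℚ, 0 < crossTime i q p ∧ crossTime i q p < l := by
      rcases lt_or_gt_of_ne hi with hc | hc
      · obtain ⟨q, h1, h2⟩ := exists_rat_btwn
          (show p.1 i + l * rayDir p i < p.1 i by nlinarith)
        refine ⟨q, div_pos_of_neg_of_neg (by linarith) hc, ?_⟩
        rw [crossTime, div_lt_iff_of_neg hc]
        linarith
      · obtain ⟨q, h1, h2⟩ := exists_rat_btwn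
          (show p.1 i < p.1 i + l * rayDir p i by nlinarith)
        refine ⟨q, div_pos (by linarith) hc, ?_⟩
        rw [crossTime, div_lt_iff₀ hc]
        linarith
    have hcΩ : crossPoint i q p ∈ Ω := by
      refine hseg _ (hf hpΓ).1 _ (hf hpΓ).2 hne ?_
      rw [openSegment_eq_image_lineMap, crossPoint, hline]
      exact ⟨_, ⟨by positivity, (div_lt_one hl0).2 hql⟩, rfl⟩
    obtain ⟨ε, hε, hεΩ⟩ := Metric.isOpen_iff.1 hΩo _ hcΩ
    have hlim := tendsto_one_div_add_atTop_nhds_zero_nat (𝕜 := ℝ)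
    have hsmall : ∀ δ > (0 : ℝ), ∀ᶠ m : ℕ in atTop, 1 / ((m : ℝ) + 1) ≤ δ := fun δ hδ =>
      hlim.eventually (Iic_mem_nhds hδ)
    have hev : ∀ᶠ m : ℕ in atTop, CrossesWithMargin Ω i q (1 / ((m : ℝ) + 1)) p := by
      filter_upwards [hsmall ε hε, hsmall _ (abs_pos.2 hi), hsmall _ hq0,
        hsmall _ (sub_pos.2 hql)] with m h1 h2 h3 h4
      exact ⟨hne, h2, h3, by linarith, (ball_subset_ball h1).trans hεΩ⟩
    obtain ⟨m₀, hm₀⟩ := eventually_atTop.1 hev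
    by_contra hnot
    simp only [mem_iUnion, not_exists] at hnot
    have hz : ∀ m ≥ m₀, μH[1] (rayCore (1 / ((m : ℝ) + 1)) p ∩ A) = 0 := by
      intro m hm
      by_contra h
      exact hnot i q m ⟨hpΓ, hm₀ m hm, h⟩
    refine hpA (measure_mono_null (t := ({p.1} ∪ {p.2}) ∪
      ⋃ (m : ℕ) (_ : m₀ ≤ m), rayCore (1 / ((m : ℝ) + 1)) p ∩ A) ?_ ?_)
    · rintro z ⟨hz, hzA⟩
      rw [← insert_endpoints_openSegment] at hz
      rcases hz with rfl | rfl | hz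
      · simp
      · simp
      right
      rw [openSegment_eq_image_lineMap] at hz
      obtain ⟨t, ht, rfl⟩ := hz
      obtain ⟨m, hm, h1, h2⟩ := ((eventually_ge_atTop m₀).and ((hsmall (t * l)
        (mul_pos ht.1 hl0)).and (hsmall ((1 - t) * l) (mul_pos (by linarith [ht.2]) hl0)))).exists
      refine mem_iUnion₂.2 ⟨m, hm, ⟨t * l, ⟨h1, by linarith⟩, ?_⟩, hzA⟩
      change p.1 + (t * l) • rayDir p = _
      rw [hline, mul_div_cancel_right₀ _ hl0.ne']
    · rw [measure_union_null_iff, measure_union_null_iff]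
      exact ⟨⟨measure_singleton _, measure_singleton _⟩,
        measure_iUnion_null fun m => measure_iUnion_null fun hm => hz m hm⟩
  refine measure_mono_null (image_mono hcover) ?_
  simp only [image_iUnion]
  exact measure_iUnion_null fun i => measure_iUnion_null fun q => measure_iUnion_null fun m =>
    hausdorffMeasure_fst_image_of_margin hΩ hΩo (by positivity) hmono hbound
      (fun p hp => (hf hp).1) hA

end Cross

lemma totalVariation_add_absolutelyContinuous {α : Type*} [MeasurableSpace α]
    (s t : SignedMeasure α) :
    (s + t).totalVariation ≪ s.totalVariation + t.totalVariation := by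
  have h := (SignedMeasure.absolutelyContinuous_ennreal_iff (s + t)
    (s.totalVariation + t.totalVariation).toENNRealVectorMeasure).1 ?_
  · rwa [VectorMeasure.ennrealToMeasure_toENNRealVectorMeasure] at h
  refine VectorMeasure.AbsolutelyContinuous.mk fun B hB h0 => ?_
  rw [Measure.toENNRealVectorMeasure_apply_measurable hB, Measure.add_apply, add_eq_zero] at h0
  rw [_root_.add_apply, s.null_of_totalVariation_zero h0.1,
    t.null_of_totalVariation_zero h0.2, add_zero]

/-- decomposition of the transport density for boundary data that is the sum of
an absolutely continuous part and an atomic part. -/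
theorem stmt0 {d : ℕ} (hd : 2 ≤ d)
    (Ω : Set (EuclideanSpace ℝ (Fin d)))
    (hΩo : IsOpen Ω) (hΩb : Bornology.IsBounded Ω) (hΩuc : UniformlyConvexSet Ω)
    (f : SignedMeasure (EuclideanSpace ℝ (Fin d)))
    (hfconc : f.totalVariation (frontier Ω)ᶜ = 0)
    (hfzero : f (frontier Ω) = 0)
    (fac fat : SignedMeasure (EuclideanSpace ℝ (Fin d)))
    (hdecomp : f = fac + fat)
    (hac : fac.totalVariation ≪ (μH[(d : ℝ) - 1]).restrict (frontier Ω))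
    (hat : ∃ D : Set (EuclideanSpace ℝ (Fin d)), D.Countable ∧ fat.totalVariation Dᶜ = 0)
    (γ : Measure (EuclideanSpace ℝ (Fin d) × EuclideanSpace ℝ (Fin d)))
    (hγ : IsOptimalPlan f.toJordanDecomposition.posPart f.toJordanDecomposition.negPart γ) :
    ∃ σac σat : Measure (EuclideanSpace ℝ (Fin d)),
      (∀ A : Set (EuclideanSpace ℝ (Fin d)), MeasurableSet A →
        transportDensity γ A = σac A + σat A) ∧
      σac ≪ (volume : Measure (EuclideanSpace ℝ (Fin d))) ∧
      ∃ segs : ℕ → EuclideanSpace ℝ (Fin d) × EuclideanSpace ℝ (Fin d),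
        σat ((⋃ n, segment ℝ (segs n).1 (segs n).2)ᶜ) = 0 := by
  obtain ⟨n, rfl⟩ : ∃ n, d = n + 1 := ⟨d - 1, by omega⟩
  obtain ⟨D, hD, hfatD⟩ := hat
  have hdim : ((n + 1 : ℕ) : ℝ) - 1 = n := by push_cast; ring
  rw [hdim] at hac
  set μp := f.toJordanDecomposition.posPart
  set μn := f.toJordanDecomposition.negPart
  have htv : f.totalVariation = μp + μn := rfl
  have hmarg₁ : γ.map Prod.fst = μp := hγ.1.1
  have hmarg₂ : γ.map Prod.snd = μn := hγ.1.2
  have hγfin : IsFiniteMeasure γ := by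
    constructor
    have : γ.map Prod.fst univ = μp univ := by rw [hmarg₁]
    rw [Measure.map_apply measurable_fst MeasurableSet.univ, preimage_univ] at this
    rw [this]
    exact measure_lt_top _ _
  have hpF : μp (frontier Ω)ᶜ = 0 ∧ μn (frontier Ω)ᶜ = 0 := by
    rwa [htv, Measure.add_apply, add_eq_zero] at hfconc
  have lift₁ : ∀ N, μp N = 0 → ∀ᵐ p ∂γ, p.1 ∉ N := fun N hN =>
    ae_of_ae_map measurable_fst.aemeasurable (p := fun x => x ∉ N)
      (by rw [hmarg₁]; exact measure_eq_zero_iff_ae_notMem.1 hN)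
  have lift₂ : ∀ N, μn N = 0 → ∀ᵐ p ∂γ, p.2 ∉ N := fun N hN =>
    ae_of_ae_map measurable_snd.aemeasurable (p := fun x => x ∉ N)
      (by rw [hmarg₂]; exact measure_eq_zero_iff_ae_notMem.1 hN)
  have hFF : ∀ᵐ p ∂γ, p ∈ frontier Ω ×ˢ frontier Ω := by
    filter_upwards [lift₁ _ hpF.1, lift₂ _ hpF.2] with p h1 h2
    exact ⟨not_not.1 h1, not_not.1 h2⟩
  have hFb : Bornology.IsBounded (frontier Ω) := hΩb.closure.subset frontier_subset_closure
  have hcost : transportCost γ ≠ ∞ := by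
    have h1 : transportCost γ ≤ ∫⁻ _, ediam (frontier Ω) ∂γ := by
      refine lintegral_mono_ae ?_
      filter_upwards [hFF] with p hp
      exact edist_le_ediam_of_mem hp.1 hp.2
    refine ne_top_of_le_ne_top ?_ h1
    rw [lintegral_const]
    exact ENNReal.mul_ne_top hFb.ediam_ne_top (measure_ne_top _ _)
  set Γ := γ.support ∩ frontier Ω ×ˢ frontier Ω
  have hΓae : ∀ᵐ p ∂γ, p ∈ Γ := by
    filter_upwards [Measure.support_mem_ae (μ := γ), hFF] with p h1 h2 using ⟨h1, h2⟩
  have hmono : ∀ p ∈ Γ, ∀ p' ∈ Γ,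
      dist p.1 p.2 + dist p'.1 p'.2 ≤ dist p.1 p'.2 + dist p'.1 p.2 := fun p hp p' hp' =>
    monotone_support_of_isOptimalPlan hγ hcost hp.1 hp'.1
  have hseg : ∀ x ∈ frontier Ω, ∀ y ∈ frontier Ω, x ≠ y → openSegment ℝ x y ⊆ Ω :=
    fun x hx y hy hxy => openSegment_subset_of_uniformlyConvexSet hΩo hΩuc
      (frontier_subset_closure hx) (frontier_subset_closure hy) hxy
  have hnull : ∀ N, μH[(n : ℝ)] N = 0 → μp (N \ D) = 0 ∧ μn (N \ D) = 0 := by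
    intro N hN
    have h1 : fac.totalVariation (N \ D) = 0 :=
      hac (measure_mono_null sdiff_subset
        (Measure.absolutelyContinuous_of_le Measure.restrict_le_self hN))
    have h2 : fat.totalVariation (N \ D) = 0 := measure_mono_null (fun _ h => h.2) hfatD
    have h3 : f.totalVariation (N \ D) = 0 := by
      rw [hdecomp]
      refine totalVariation_add_absolutelyContinuous fac fat ?_
      rw [Measure.add_apply, h1, h2, add_zero]
    rwa [htv, Measure.add_apply, add_eq_zero] at h3
  have hS : MeasurableSet (D ×ˢ D) := hD.measurableSet.prod hD.measurableSet
  refine ⟨transportDensityMeasure (γ.restrict (D ×ˢ D)ᶜ),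
    transportDensityMeasure (γ.restrict (D ×ˢ D)), ?_, ?_, ?_⟩
  · intro A hA
    rw [transportDensityMeasure_apply _ hA, transportDensityMeasure_apply _ hA]
    exact (lintegral_add_compl _ hS).symm.trans (add_comm _ _)
  · refine Measure.AbsolutelyContinuous.mk fun A hA hA0 => ?_
    rw [transportDensityMeasure_apply _ hA]
    refine lintegral_eq_zero_of_ae_eq_zero ((ae_restrict_iff' hS.compl).2 ?_)
    have hN₁ := hausdorffMeasure_fst_image_of_null hΩuc.1 hΩo hΩb hseg inter_subset_right hmono hA0
    have hN₂ := hausdorffMeasure_fst_image_of_null (Γ := Prod.swap ⁻¹' Γ) hΩuc.1 hΩo hΩb hseg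
      (fun p hp => ⟨hp.2.2, hp.2.1⟩) (fun p hp p' hp' => by
        have := hmono _ hp _ hp'
        simp only [Prod.fst_swap, Prod.snd_swap] at this
        rw [dist_comm p.2, dist_comm p'.2, dist_comm p.2, dist_comm p'.2] at this
        linarith) hA0
    filter_upwards [hΓae, lift₁ _ (hnull _ hN₁).1, lift₂ _ (hnull _ hN₂).2] with p hp h1 h2 hpD
    by_contra hbad
    have hm1 : p.1 ∈ D := by
      by_contra h
      exact h1 ⟨⟨p, ⟨hp, hbad⟩, rfl⟩, h⟩
    have hm2 : p.2 ∈ D := by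
      by_contra h
      refine h2 ⟨⟨p.swap, ⟨hp, ?_⟩, rfl⟩, h⟩
      rw [Prod.fst_swap, Prod.snd_swap, segment_symm]
      exact hbad
    exact hpD ⟨hm1, hm2⟩
  · obtain ⟨segs, hsegs⟩ : ∃ segs : ℕ → EuclideanSpace ℝ (Fin (n + 1)) ×
        EuclideanSpace ℝ (Fin (n + 1)), insert 0 (D ×ˢ D) = range segs :=
      ((hD.prod hD).insert 0).exists_eq_range (insert_nonempty _ _)
    refine ⟨segs, ?_⟩
    have hmeas : MeasurableSet (⋃ k, segment ℝ (segs k).1 (segs k).2)ᶜ := by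
      refine (MeasurableSet.iUnion fun k => ?_).compl
      rw [segment_eq_image_lineMap]
      exact (isCompact_Icc.image AffineMap.lineMap_continuous).isClosed.measurableSet
    rw [transportDensityMeasure_apply _ hmeas]
    refine lintegral_eq_zero_of_ae_eq_zero ((ae_restrict_iff' hS).2 (ae_of_all _ fun p hp => ?_))
    obtain ⟨k, hk⟩ : p ∈ range segs := hsegs ▸ mem_insert_of_mem _ hp
    have : segment ℝ p.1 p.2 ∩ (⋃ k, segment ℝ (segs k).1 (segs k).2)ᶜ = ∅ := by
      rw [← sdiff_eq, sdiff_eq_empty, ← hk]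
      exact subset_iUnion (fun k => segment ℝ (segs k).1 (segs k).2) k
    exact (congrArg _ this).trans measure_empty
end
end

section
/- Let d ≥ 2 and let Ω ⊂ ℝ^d be an open, bounded, uniformly convex set. Let f⁺ = h⁺·ℋ^{d−1}|_{∂Ω} and f⁻ = h⁻·ℋ^{d−1}|_{∂Ω}, where h⁺, h⁻ : ∂Ω → [0,∞) are bounded Borel functions with f⁺(∂Ω) = f⁻(∂Ω), and suppose that the supports of f⁺ and f⁻ are disjoint. Let γ be an optimal transport plan between f⁺ and f⁻. Then there exists a constant C such that σ_γ(A) ≤ C · Leb(A) for every Borel set A ⊆ Ω; that is, the transport density σ_γ is absolutely continuous on Ω with essentially bounded density. -/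
open MeasureTheory Set Metric Filter
open scoped ENNReal NNReal Topology

noncomputable section

section Geometry

variable {V : Type*} [NormedAddCommGroup V] [InnerProductSpace ℝ V]

/-- Comparison of a long side `‖w - (a • e' + b • e)‖` with `a + b`, for unit vectors `e`, `e'`. -/
lemma long_side_deficit {e e' w : V} (he : ‖e‖ = 1) (he' : ‖e'‖ = 1) {a b : ℝ}
    (ha : 0 ≤ a) (hb : 0 < b) :
    a * b / (a + b) * ‖e - e'‖ ^ 2 ≤ ‖w‖ ^ 2 / (a + b) - 2 * inner ℝ w e
      - 2 * (a / (a + b)) * (inner ℝ w e' - inner ℝ w e)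
      - 2 * (‖w - (a • e' + b • e)‖ - (a + b)) := by
  set N := ‖w - (a • e' + b • e)‖
  have hN : N ^ 2 = ‖w‖ ^ 2 - 2 * (a * inner ℝ w e' + b * inner ℝ w e) + (a + b) ^ 2
      - a * b * ‖e - e'‖ ^ 2 := by
    simp only [N, norm_sub_sq_real, norm_add_sq_real, inner_add_right, inner_smul_left,
      inner_smul_right, norm_smul, he, he', Real.norm_eq_abs, mul_one, sq_abs,
      real_inner_comm e e']
    simp
    ring
  have hs : 0 < a + b := by linarith
  have key : a * b * ‖e - e'‖ ^ 2 ≤ ‖w‖ ^ 2 - 2 * inner ℝ w e * (a + b)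
      - 2 * a * (inner ℝ w e' - inner ℝ w e) - 2 * (N - (a + b)) * (a + b) := by
    nlinarith [sq_nonneg (N - (a + b))]
  rw [div_mul_eq_mul_div, div_le_iff₀ hs]
  refine key.trans_eq ?_
  field_simp

lemma transverse_spread {e e' w : V} (he : ‖e‖ = 1) (he' : ‖e'‖ = 1) {a b a' b' : ℝ}
    (ha : 0 ≤ a) (hb : 0 < b) (ha' : 0 ≤ a') (hb' : 0 < b')
    (h : a + b + (a' + b') ≤ ‖w - (a' • e' + b • e)‖ + ‖w + (a • e + b' • e')‖) :
    a' * b / (a' + b) * ‖e - e'‖ ^ 2 + a * b' / (a + b') * ‖e - e'‖ ^ 2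
      ≤ ‖w‖ ^ 2 / (a' + b) + ‖w‖ ^ 2 / (a + b') + 2 * (‖w‖ * ‖e - e'‖) := by
  have h1 := long_side_deficit (w := w) he he' ha' hb
  have h2 := long_side_deficit (w := -w) he' he ha hb'
  rw [show -w - (a • e + b' • e') = -(w + (a • e + b' • e')) by abel, norm_neg, norm_neg,
    norm_sub_rev e' e, inner_neg_left, inner_neg_left] at h2
  have hP : |inner ℝ w e' - inner ℝ w e| ≤ ‖w‖ * ‖e - e'‖ := by
    rw [← inner_sub_right, norm_sub_rev e e']
    exact abs_real_inner_le_norm _ _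
  have hc : |1 - a' / (a' + b) - a / (a + b')| ≤ 1 := by
    have e1 : 0 ≤ a' / (a' + b) := by positivity
    have e2 : a' / (a' + b) ≤ 1 := (div_le_one (by linarith)).2 (by linarith)
    have e3 : 0 ≤ a / (a + b') := by positivity
    have e4 : a / (a + b') ≤ 1 := (div_le_one (by linarith)).2 (by linarith)
    rw [abs_le]
    constructor <;> linarith
  have hm : (inner ℝ w e' - inner ℝ w e) * (1 - a' / (a' + b) - a / (a + b'))
      ≤ ‖w‖ * ‖e - e'‖ := by
    refine (le_abs_self _).trans ?_
    rw [abs_mul]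
    exact (mul_le_mul hP hc (abs_nonneg _) ((abs_nonneg _).trans hP)).trans (mul_one _).le
  linarith

lemma mul_le_of_quadratic_bound {m θ W D κ K : ℝ} (hm : m ≤ D) (hD : 0 ≤ D)
    (hκ : 0 < κ) (hK : 0 ≤ K) (hW : 0 ≤ W) (hθ : 0 ≤ θ)
    (h : m * κ * θ ^ 2 ≤ K * W ^ 2 + 2 * (W * θ)) :
    m * θ ≤ (D + (K + 2) / κ) * W := by
  have hq : 0 ≤ (K + 2) / κ * W := by positivity
  rcases le_or_gt θ W with hle | hlt
  · nlinarith [mul_le_mul_of_nonneg_right hm hθ, mul_le_mul_of_nonneg_left hle hD]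
  · have hθ' : 0 < θ := hW.trans_lt hlt
    have h1 : (m * κ * θ) * θ ≤ ((K + 2) * W) * θ := by
      nlinarith [mul_le_mul_of_nonneg_left hlt.le (mul_nonneg hK hW)]
    have h2 := le_of_mul_le_mul_right h1 hθ'
    have h3 : m * θ ≤ (K + 2) / κ * W := by
      rw [div_mul_eq_mul_div, le_div_iff₀ hκ]
      linarith
    nlinarith [mul_nonneg hD hW]

/-- On the first halves of two segments whose endpoints are monotone for the distance cost, the
directions depend on the position in a Lipschitz way, after multiplication by the distance to the
starting point. -/
lemma mul_direction_sub_le {δ D : ℝ} (hδ : 0 < δ) {e e' w : V} (he : ‖e‖ = 1) (he' : ‖e'‖ = 1)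
    {a b a' b' : ℝ} (ha : 0 ≤ a) (hb : δ ≤ b) (ha' : 0 ≤ a') (hb' : δ ≤ b')
    (haD : a ≤ D) (haD' : a' ≤ D) (hbD : b ≤ D) (hbD' : b' ≤ D)
    (h : a + b + (a' + b') ≤ ‖w - (a' • e' + b • e)‖ + ‖w + (a • e + b' • e')‖) :
    a * ‖e - e'‖ ≤ (D + (2 / δ + 2) / (δ / (2 * D))) * ‖w‖ ∧
    a' * ‖e - e'‖ ≤ (D + (2 / δ + 2) / (δ / (2 * D))) * ‖w‖ := by
  have hD : 0 < D := by linarith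
  have hb0 : 0 < b := by linarith
  have hb0' : 0 < b' := by linarith
  have key := transverse_spread he he' ha hb0 ha' hb0' h
  have lower : ∀ {s t : ℝ}, 0 ≤ s → s ≤ D → δ ≤ t → t ≤ D → s * (δ / (2 * D)) ≤ s * t / (s + t) := by
    intro s t hs hsD ht htD
    rw [mul_div_assoc]
    refine mul_le_mul_of_nonneg_left ?_ hs
    exact div_le_div₀ (by linarith) ht (by linarith) (by linarith)
  have upper : ∀ {s t : ℝ}, 0 ≤ s → δ ≤ t → ‖w‖ ^ 2 / (s + t) ≤ ‖w‖ ^ 2 / δ := by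
    intro s t hs ht
    exact div_le_div_of_nonneg_left (by positivity) hδ (by linarith)
  have l1 := mul_le_mul_of_nonneg_right (lower ha' haD' hb hbD) (sq_nonneg ‖e - e'‖)
  have l2 := mul_le_mul_of_nonneg_right (lower ha haD hb' hbD') (sq_nonneg ‖e - e'‖)
  have u1 := upper ha' hb
  have u2 := upper ha hb'
  have p1 : 0 ≤ a' * (δ / (2 * D)) * ‖e - e'‖ ^ 2 := by positivity
  have p2 : 0 ≤ a * (δ / (2 * D)) * ‖e - e'‖ ^ 2 := by positivity
  have hK : 2 / δ * ‖w‖ ^ 2 = ‖w‖ ^ 2 / δ + ‖w‖ ^ 2 / δ := by ring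
  constructor
  · exact mul_le_of_quadratic_bound haD hD.le (by positivity) (by positivity) (norm_nonneg _)
      (norm_nonneg _) (by linarith)
  · exact mul_le_of_quadratic_bound haD' hD.le (by positivity) (by positivity) (norm_nonneg _)
      (norm_nonneg _) (by linarith)

lemma abs_mul_le_of_transverse {c ρ B : ℝ} {e n p : V} (hn : ‖n‖ = 1)
    (hρ : 0 ≤ ρ) (hne : c ≤ inner ℝ n e) (hp : ‖p‖ ≤ B) (h : 0 ≤ inner ℝ n (p - ρ • e)) :
    c * ρ ≤ B := by
  rw [inner_sub_right, inner_smul_right] at h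
  have h1 := real_inner_le_norm n p
  rw [hn, one_mul] at h1
  nlinarith [mul_le_mul_of_nonneg_left hne hρ]

/-- The starting point of a transport ray is a Lipschitz function of a point in its first half. -/
lemma norm_start_sub_le {δ D c : ℝ} (hδ : 0 < δ) (hc : 0 < c) {e e' n n' x x' : V}
    (he : ‖e‖ = 1) (he' : ‖e'‖ = 1) (hn : ‖n‖ = 1) (hn' : ‖n'‖ = 1)
    {a b a' b' : ℝ} (ha : 0 ≤ a) (hb : δ ≤ b) (ha' : 0 ≤ a') (hb' : δ ≤ b')
    (haD : a ≤ D) (haD' : a' ≤ D) (hbD : b ≤ D) (hbD' : b' ≤ D)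
    (hne : c ≤ inner ℝ n e) (hne' : c ≤ inner ℝ n' e')
    (hx : 0 ≤ inner ℝ n (x' - x)) (hx' : 0 ≤ inner ℝ n' (x - x'))
    (h : a + b + (a' + b') ≤ ‖x' - (x + (a + b) • e)‖ + ‖x - (x' + (a' + b') • e')‖) :
    ‖x - x'‖ ≤ (1 + (D + (2 / δ + 2) / (δ / (2 * D)))) * (1 + 1 / c)
      * ‖(x + a • e) - (x' + a' • e')‖ := by
  set w := (x' + a' • e') - (x + a • e) with hw
  have e1 : x' - (x + (a + b) • e) = w - (a' • e' + b • e) := by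
    rw [hw, add_smul]; abel
  have e2 : x - (x' + (a' + b') • e') = -(w + (a • e + b' • e')) := by
    rw [hw, add_smul]; abel
  rw [e1, e2, norm_neg] at h
  obtain ⟨k1, k2⟩ := mul_direction_sub_le hδ he he' ha hb ha' hb' haD haD' hbD hbD' h
  rw [norm_sub_rev (x + a • e), ← hw]
  set C := D + (2 / δ + 2) / (δ / (2 * D))
  have b1 : ‖w + a • (e - e')‖ ≤ (1 + C) * ‖w‖ := by
    refine (norm_add_le _ _).trans ?_
    rw [norm_smul, Real.norm_of_nonneg ha]
    linarith
  have b2 : ‖w + a' • (e - e')‖ ≤ (1 + C) * ‖w‖ := by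
    refine (norm_add_le _ _).trans ?_
    rw [norm_smul, Real.norm_of_nonneg ha']
    linarith
  have hB : (1 + C) * (1 + 1 / c) * ‖w‖ = (1 + C) * ‖w‖ + (1 + C) * ‖w‖ / c := by ring
  rw [hB]
  rcases le_total a' a with hle | hle
  · have hxx : x - x' = -(w + a • (e - e')) - (a - a') • e' := by
      rw [hw, smul_sub, sub_smul]; abel
    have := abs_mul_le_of_transverse (B := (1 + C) * ‖w‖) (p := -(w + a • (e - e'))) hn' (sub_nonneg.2 hle) hne'
      (by rwa [norm_neg]) (by rwa [← hxx])
    have hρ : a - a' ≤ (1 + C) * ‖w‖ / c := by rw [le_div_iff₀ hc]; linarith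
    rw [hxx]
    refine (norm_sub_le _ _).trans ?_
    rw [norm_neg, norm_smul, he', mul_one, Real.norm_of_nonneg (sub_nonneg.2 hle)]
    linarith
  · have hxx : x' - x = (w + a' • (e - e')) - (a' - a) • e := by
      rw [hw, smul_sub, sub_smul]; abel
    have := abs_mul_le_of_transverse (p := w + a' • (e - e')) hn (sub_nonneg.2 hle) hne
      b2 (by rwa [← hxx])
    have hρ : a' - a ≤ (1 + C) * ‖w‖ / c := by rw [le_div_iff₀ hc]; linarith
    rw [norm_sub_rev, hxx]
    refine (norm_sub_le _ _).trans ?_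
    rw [norm_smul, he, mul_one, Real.norm_of_nonneg (sub_nonneg.2 hle)]
    linarith

/-- The same statement for segments given by their endpoints. -/
lemma exists_norm_start_sub_le {δ D R : ℝ} (hδ : 0 < δ) (hR : 0 < R) :
    ∃ L : ℝ≥0, ∀ x y x' y' n n' : V, ∀ t t' : ℝ, ‖n‖ = 1 → ‖n'‖ = 1 →
      δ ≤ ‖y - x‖ → δ ≤ ‖y' - x'‖ → ‖y - x‖ ≤ D → ‖y' - x'‖ ≤ D →
      ‖y - x‖ ^ 2 ≤ R * inner ℝ n (y - x) → ‖y' - x'‖ ^ 2 ≤ R * inner ℝ n' (y' - x') →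
      0 ≤ inner ℝ n (x' - x) → 0 ≤ inner ℝ n' (x - x') →
      0 ≤ t → t ≤ 1 / 2 → 0 ≤ t' → t' ≤ 1 / 2 →
      ‖y - x‖ + ‖y' - x'‖ ≤ ‖x' - y‖ + ‖x - y'‖ →
      ‖x - x'‖ ≤ L * ‖(x + t • (y - x)) - (x' + t' • (y' - x'))‖ := by
  refine ⟨((1 + (D + (2 / (δ / 2) + 2) / ((δ / 2) / (2 * D)))) * (1 + 1 / (δ / R))).toNNReal, ?_⟩
  intro x y x' y' n n' t t' hn hn' hδ1 hδ2 hD1 hD2 hR1 hR2 hx hx' ht0 ht ht0' ht' h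
  have hl : 0 < ‖y - x‖ := by linarith
  have hl' : 0 < ‖y' - x'‖ := by linarith
  have unit : ∀ {v : V}, 0 < ‖v‖ → ‖‖v‖⁻¹ • v‖ = 1 := by
    intro v hv
    rw [norm_smul, norm_inv, norm_norm, inv_mul_cancel₀ hv.ne']
  have resc : ∀ {v : V} (s : ℝ), 0 < ‖v‖ → (s * ‖v‖) • (‖v‖⁻¹ • v) = s • v := by
    intro v s hv
    rw [smul_smul, mul_assoc, mul_inv_cancel₀ hv.ne', mul_one]
  have transv : ∀ {v m : V}, δ ≤ ‖v‖ → ‖v‖ ^ 2 ≤ R * inner ℝ m v →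
      δ / R ≤ inner ℝ m (‖v‖⁻¹ • v) := by
    intro v m hv hm
    have hv0 : 0 < ‖v‖ := by linarith
    rw [inner_smul_right, div_le_iff₀ hR, inv_mul_eq_div, div_mul_eq_mul_div, le_div_iff₀ hv0]
    nlinarith
  have e1 : x + (t * ‖y - x‖ + (1 - t) * ‖y - x‖) • (‖y - x‖⁻¹ • (y - x)) = y := by
    rw [← add_mul, resc _ hl]; simp
  have e2 : x' + (t' * ‖y' - x'‖ + (1 - t') * ‖y' - x'‖) • (‖y' - x'‖⁻¹ • (y' - x')) = y' := by
    rw [← add_mul, resc _ hl']; simp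
  have main := norm_start_sub_le (D := D) (x := x) (x' := x') (a := t * ‖y - x‖)
    (b := (1 - t) * ‖y - x‖) (a' := t' * ‖y' - x'‖) (b' := (1 - t') * ‖y' - x'‖)
    (half_pos hδ) (div_pos hδ hR) (unit hl) (unit hl') hn hn'
    (by positivity) (by nlinarith) (by positivity) (by nlinarith) (by nlinarith) (by nlinarith)
    (by nlinarith) (by nlinarith) (transv hδ1 hR1) (transv hδ2 hR2) hx hx'
    (by rw [e1, e2]; linarith)
  rw [resc _ hl, resc _ hl'] at main
  refine main.trans (mul_le_mul_of_nonneg_right (Real.le_coe_toNNReal _) (norm_nonneg _))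

end Geometry

section Monotonicity

variable {α : Type*} [PseudoMetricSpace α] [SecondCountableTopology α] [MeasurableSpace α]
  [BorelSpace α]

/-- The second-order competitor: exchanging the targets of small multiples of the pieces of an
optimal plan carried by `U` and by `V` does not decrease the cost. -/
lemma IsOptimalPlan.exchange_cost_le {μ ν : Measure α} {γ : Measure (α × α)} [IsFiniteMeasure γ]
    (hγ : IsOptimalPlan μ ν γ) (hcost : transportCost γ ≠ ∞) {U V : Set (α × α)}
    (hU : γ U ≠ 0) (hV : γ V ≠ 0) {ε : ℝ≥0∞} (hUm : MeasurableSet U) (hVm : MeasurableSet V)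
    (h : ∀ p ∈ U, ∀ q ∈ V,
      edist p.1 q.2 + edist q.1 p.2 + ε ≤ edist p.1 p.2 + edist q.1 q.2) : ε = 0 := by
  by_contra hε
  set γ₁ := γ.restrict U with hγ₁
  set γ₂ := γ.restrict V with hγ₂
  set k : ℝ≥0∞ := (2 * (γ U + γ V))⁻¹ with hk
  have hs0 : γ U + γ V ≠ 0 := by simp [hU]
  have hsT : γ U + γ V ≠ ∞ := by simp
  have hk0 : k ≠ 0 := ENNReal.inv_ne_zero.2 (ENNReal.mul_ne_top (by simp) hsT)
  have half : ∀ t, t ≤ γ U + γ V → k * t ≤ 2⁻¹ := by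
    intro t ht
    calc k * t ≤ k * (γ U + γ V) := by gcongr
      _ = 2⁻¹ := by
        rw [hk, ENNReal.mul_inv (by simp) (by simp), mul_assoc, ENNReal.inv_mul_cancel hs0 hsT,
          mul_one]
  have hle : (k * γ V) • γ₁ + (k * γ U) • γ₂ ≤ γ := by
    calc (k * γ V) • γ₁ + (k * γ U) • γ₂ ≤ (2⁻¹ : ℝ≥0∞) • γ + (2⁻¹ : ℝ≥0∞) • γ := by
          gcongr
          · exact half _ le_add_self
          · exact Measure.restrict_le_self
          · exact half _ le_self_add
          · exact Measure.restrict_le_self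
      _ = γ := by rw [← add_smul, ENNReal.inv_two_add_inv_two, one_smul]
  have hfin : IsFiniteMeasure ((k * γ V) • γ₁ + (k * γ U) • γ₂) :=
    isFiniteMeasure_of_le γ hle
  set rest := γ - ((k * γ V) • γ₁ + (k * γ U) • γ₂) with hrest
  have hsum : rest + ((k * γ V) • γ₁ + (k * γ U) • γ₂) = γ := Measure.sub_add_cancel_of_le hle
  set f₁₂ : (α × α) × (α × α) → α × α := fun q => (q.1.1, q.2.2)
  set f₂₁ : (α × α) × (α × α) → α × α := fun q => (q.2.1, q.1.2)
  have hf₁₂ : Measurable f₁₂ := by fun_prop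
  have hf₂₁ : Measurable f₂₁ := by fun_prop
  set P₁₂ := (γ₁.prod γ₂).map f₁₂
  set P₂₁ := (γ₁.prod γ₂).map f₂₁
  set γ' := rest + k • (P₁₂ + P₂₁) with hγ'
  have u₁ : γ₁ univ = γ U := by simp [hγ₁]
  have u₂ : γ₂ univ = γ V := by simp [hγ₂]
  have m1 : P₁₂.map Prod.fst = γ V • γ₁.map Prod.fst := by
    rw [Measure.map_map measurable_fst hf₁₂, show Prod.fst ∘ f₁₂ = Prod.fst ∘ Prod.fst from rfl,
      ← Measure.map_map measurable_fst measurable_fst, Measure.map_fst_prod, Measure.map_smul, u₂]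
  have m2 : P₁₂.map Prod.snd = γ U • γ₂.map Prod.snd := by
    rw [Measure.map_map measurable_snd hf₁₂, show Prod.snd ∘ f₁₂ = Prod.snd ∘ Prod.snd from rfl,
      ← Measure.map_map measurable_snd measurable_snd, Measure.map_snd_prod, Measure.map_smul, u₁]
  have m3 : P₂₁.map Prod.fst = γ U • γ₂.map Prod.fst := by
    rw [Measure.map_map measurable_fst hf₂₁, show Prod.fst ∘ f₂₁ = Prod.fst ∘ Prod.snd from rfl,
      ← Measure.map_map measurable_fst measurable_snd, Measure.map_snd_prod, Measure.map_smul, u₁]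
  have m4 : P₂₁.map Prod.snd = γ V • γ₁.map Prod.snd := by
    rw [Measure.map_map measurable_snd hf₂₁, show Prod.snd ∘ f₂₁ = Prod.snd ∘ Prod.fst from rfl,
      ← Measure.map_map measurable_snd measurable_fst, Measure.map_fst_prod, Measure.map_smul, u₂]
  have hplan : IsTransportPlan μ ν γ' := by
    refine ⟨?_, ?_⟩
    · rw [← hγ.1.1]
      conv_rhs => rw [← hsum]
      simp only [hγ', Measure.map_add _ _ measurable_fst, Measure.map_smul, m1, m3, smul_add,
        smul_smul]
    · rw [← hγ.1.2]
      conv_rhs => rw [← hsum]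
      simp only [hγ', Measure.map_add _ _ measurable_snd, Measure.map_smul, m2, m4, smul_add,
        smul_smul]
      rw [add_comm ((k * γ U) • _)]
  have hc : Measurable fun p : α × α => edist p.1 p.2 := measurable_fst.edist measurable_snd
  have cost' : transportCost γ' = transportCost rest
      + k * ∫⁻ q, (edist q.1.1 q.2.2 + edist q.2.1 q.1.2) ∂(γ₁.prod γ₂) := by
    simp only [transportCost, hγ', lintegral_add_measure, lintegral_smul_measure, smul_eq_mul]
    rw [lintegral_map hc hf₁₂, lintegral_map hc hf₂₁, lintegral_add_left (by fun_prop)]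
  have cost : transportCost γ = transportCost rest
      + k * ∫⁻ q, (edist q.1.1 q.1.2 + edist q.2.1 q.2.2) ∂(γ₁.prod γ₂) := by
    have i1 : ∫⁻ q, edist q.1.1 q.1.2 ∂(γ₁.prod γ₂) = γ V * ∫⁻ p, edist p.1 p.2 ∂γ₁ := by
      rw [← u₂, ← smul_eq_mul, ← lintegral_smul_measure, ← Measure.map_fst_prod,
        lintegral_map hc measurable_fst]
    have i2 : ∫⁻ q, edist q.2.1 q.2.2 ∂(γ₁.prod γ₂) = γ U * ∫⁻ p, edist p.1 p.2 ∂γ₂ := by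
      rw [← u₁, ← smul_eq_mul, ← lintegral_smul_measure, ← Measure.map_snd_prod,
        lintegral_map hc measurable_snd]
    conv_lhs => rw [← hsum]
    simp only [transportCost, lintegral_add_measure, lintegral_smul_measure, smul_eq_mul]
    rw [lintegral_add_left (by fun_prop), i1, i2]
    ring
  have gain : (∫⁻ q, (edist q.1.1 q.2.2 + edist q.2.1 q.1.2) ∂(γ₁.prod γ₂)) + ε * (γ U * γ V)
      ≤ ∫⁻ q, (edist q.1.1 q.1.2 + edist q.2.1 q.2.2) ∂(γ₁.prod γ₂) := by
    have e : ε * (γ U * γ V) = ∫⁻ _, ε ∂(γ₁.prod γ₂) := by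
      rw [lintegral_const, ← univ_prod_univ, Measure.prod_prod, u₁, u₂]
    rw [e, ← lintegral_add_right _ measurable_const]
    apply lintegral_mono_ae
    have hprod : γ₁.prod γ₂ = (γ.prod γ).restrict (U ×ˢ V) := by rw [Measure.prod_restrict]
    rw [hprod]
    filter_upwards [ae_restrict_mem (hUm.prod hVm)] with q hq
    exact h q.1 hq.1 q.2 hq.2
  have final : transportCost γ + k * (ε * (γ U * γ V)) ≤ transportCost γ := by
    calc transportCost γ + k * (ε * (γ U * γ V))
        ≤ transportCost γ' + k * (ε * (γ U * γ V)) := by gcongr; exact hγ.2 _ hplan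
      _ = transportCost rest
        + k * ((∫⁻ q, (edist q.1.1 q.2.2 + edist q.2.1 q.1.2) ∂(γ₁.prod γ₂))
          + ε * (γ U * γ V)) := by rw [cost']; ring
      _ ≤ transportCost γ := by rw [cost]; gcongr
  have hpos : k * (ε * (γ U * γ V)) ≠ 0 := mul_ne_zero hk0 (mul_ne_zero hε (mul_ne_zero hU hV))
  exact absurd final (not_le.2 (ENNReal.lt_add_right hcost hpos))

/-- The support of an optimal plan is monotone for the distance cost. -/
lemma IsOptimalPlan.dist_add_dist_le {μ ν : Measure α} {γ : Measure (α × α)} [IsFiniteMeasure γ]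
    (hγ : IsOptimalPlan μ ν γ) (hcost : transportCost γ ≠ ∞) {p q : α × α}
    (hp : p ∈ γ.support) (hq : q ∈ γ.support) :
    dist p.1 p.2 + dist q.1 q.2 ≤ dist p.1 q.2 + dist q.1 p.2 := by
  by_contra! hlt
  set ε := (dist p.1 p.2 + dist q.1 q.2 - (dist p.1 q.2 + dist q.1 p.2)) / 9 with hε
  have hε0 : 0 < ε := by rw [hε]; linarith
  rw [Measure.mem_support_iff_forall] at hp hq
  have := hγ.exchange_cost_le hcost (hp _ (ball_mem_nhds p hε0)).ne' (hq _ (ball_mem_nhds q hε0)).ne'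
    (ε := ENNReal.ofReal ε) measurableSet_ball measurableSet_ball ?_
  · exact hε0.not_ge (ENNReal.ofReal_eq_zero.1 this)
  intro p' hp' q' hq'
  rw [mem_ball, Prod.dist_eq, max_lt_iff] at hp' hq'
  simp only [edist_dist]
  rw [← ENNReal.ofReal_add dist_nonneg dist_nonneg, ← ENNReal.ofReal_add dist_nonneg dist_nonneg,
    ← ENNReal.ofReal_add (add_nonneg dist_nonneg dist_nonneg) hε0.le]
  apply ENNReal.ofReal_le_ofReal
  have t1 := dist_triangle4 p'.1 p.1 q.2 q'.2
  have t2 := dist_triangle4 q'.1 q.1 p.2 p'.2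
  have t3 := dist_triangle4 p.1 p'.1 p'.2 p.2
  have t4 := dist_triangle4 q.1 q'.1 q'.2 q.2
  rw [dist_comm q.2 q'.2] at t1
  rw [dist_comm p.2 p'.2] at t2
  rw [dist_comm p.1 p'.1] at t3
  rw [dist_comm q.1 q'.1] at t4
  linarith [hp'.1, hp'.2, hq'.1, hq'.2]

end Monotonicity

section Hausdorff

/-- A relation that is Lipschitz from right to left does not increase the Hausdorff measure. -/
lemma hausdorffMeasure_le_of_relation {X Y : Type*} [MetricSpace X] [MeasurableSpace X]
    [BorelSpace X] [MetricSpace Y] [MeasurableSpace Y] [BorelSpace Y] {s : ℝ} (hs : 0 ≤ s)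
    {K : ℝ≥0} {E : Set X} {F : Set Y} (r : X → Y → Prop)
    (hr : ∀ x y x' y', r x y → r x' y' → dist x x' ≤ K * dist y y')
    (hE : ∀ x ∈ E, ∃ y ∈ F, r x y) : μH[s] E ≤ (K : ℝ≥0∞) ^ s * μH[s] F := by
  rcases E.eq_empty_or_nonempty with rfl | ⟨x₀, -⟩
  · simp
  have : Nonempty X := ⟨x₀⟩
  set F' := {y ∈ F | ∃ x, r x y}
  have hF : ∀ y ∈ F', ∃ x, r x y := fun y hy => hy.2
  choose! f hf using hF
  have hlip : LipschitzOnWith K f F' :=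
    LipschitzOnWith.of_dist_le_mul fun y hy y' hy' => hr _ _ _ _ (hf y hy) (hf y' hy')
  have hsub : E ⊆ f '' F' := by
    intro x hx
    obtain ⟨y, hy, hxy⟩ := hE x hx
    refine ⟨y, ⟨hy, x, hxy⟩, ?_⟩
    have := hr _ _ _ _ (hf y ⟨hy, x, hxy⟩) hxy
    rw [dist_self, mul_zero] at this
    exact dist_le_zero.1 this
  calc μH[s] E ≤ μH[s] (f '' F') := measure_mono hsub
    _ ≤ (K : ℝ≥0∞) ^ s * μH[s] F' := hlip.hausdorffMeasure_image_le hs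
    _ ≤ (K : ℝ≥0∞) ^ s * μH[s] F := by gcongr; exact sep_subset _ _

end Hausdorff

section Coordinates

variable {k : ℕ}

/-- The coordinates of `v` other than the `i`-th one. -/
def dropCoord (i : Fin (k + 1)) (v : EuclideanSpace ℝ (Fin (k + 1))) : Fin k → ℝ :=
  fun j => v (i.succAbove j)

/-- The point with `i`-th coordinate `s` and other coordinates `w`. -/
def insertCoord (i : Fin (k + 1)) (s : ℝ) (w : Fin k → ℝ) : EuclideanSpace ℝ (Fin (k + 1)) :=
  WithLp.toLp 2 (i.insertNth s w)

lemma insertCoord_dropCoord (i : Fin (k + 1)) (v : EuclideanSpace ℝ (Fin (k + 1))) :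
    insertCoord i (v i) (dropCoord i v) = v := by
  ext j
  refine Fin.succAboveCases i ?_ (fun j => ?_) j <;> simp [insertCoord, dropCoord]

lemma dropCoord_sub (i : Fin (k + 1)) (v v' : EuclideanSpace ℝ (Fin (k + 1))) :
    dropCoord i (v - v') = dropCoord i v - dropCoord i v' := rfl

lemma abs_apply_succAbove_le (i : Fin (k + 1)) (v : EuclideanSpace ℝ (Fin (k + 1))) (j : Fin k) :
    |v (i.succAbove j)| ≤ ‖dropCoord i v‖ :=
  norm_le_pi_norm (dropCoord i v) j

lemma norm_le_apply_add_dropCoord (i : Fin (k + 1)) (v : EuclideanSpace ℝ (Fin (k + 1))) :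
    ‖v‖ ≤ |v i| + (k + 1) * ‖dropCoord i v‖ := by
  refine abs_le_of_sq_le_sq' ?_ (by positivity) |>.2
  rw [EuclideanSpace.real_norm_sq_eq, Fin.sum_univ_succAbove _ i]
  have h : ∑ j : Fin k, v (i.succAbove j) ^ 2 ≤ ∑ _j : Fin k, ‖dropCoord i v‖ ^ 2 := by
    refine Finset.sum_le_sum fun j _ => ?_
    rw [← sq_abs]
    exact pow_le_pow_left₀ (abs_nonneg _) (abs_apply_succAbove_le i v j) 2
  rw [Finset.sum_const, Finset.card_univ, Fintype.card_fin, nsmul_eq_mul] at h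
  have h0 : (0 : ℝ) ≤ k := k.cast_nonneg
  have h1 := sq_nonneg ‖dropCoord i v‖
  have h2 : 0 ≤ |v i| * ((k + 1) * ‖dropCoord i v‖) := by positivity
  nlinarith [sq_abs (v i), mul_nonneg h0 h1, mul_nonneg (mul_nonneg h0 h0) h1]

lemma exists_norm_le_apply (v : EuclideanSpace ℝ (Fin (k + 1))) :
    ∃ i, ‖v‖ ≤ (k + 1) * |v i| := by
  obtain ⟨i, -, hi⟩ := Finset.exists_max_image Finset.univ (fun i => |v i|) ⟨0, Finset.mem_univ _⟩
  refine ⟨i, abs_le_of_sq_le_sq' ?_ (by positivity) |>.2⟩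
  rw [EuclideanSpace.real_norm_sq_eq]
  have h : ∑ j, v j ^ 2 ≤ ∑ _j : Fin (k + 1), |v i| ^ 2 := by
    refine Finset.sum_le_sum fun j hj => ?_
    rw [← sq_abs (v j)]
    exact pow_le_pow_left₀ (abs_nonneg _) (hi j hj) 2
  rw [Finset.sum_const, Finset.card_univ, Fintype.card_fin, nsmul_eq_mul] at h
  push_cast at h
  have h0 : (0 : ℝ) ≤ k := k.cast_nonneg
  nlinarith [sq_nonneg |v i|, mul_nonneg h0 (sq_nonneg |v i|),
    mul_nonneg (mul_nonneg h0 h0) (sq_nonneg |v i|)]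

lemma neg_mul_apply_le_of_inner_nonneg (i : Fin (k + 1)) {n v : EuclideanSpace ℝ (Fin (k + 1))}
    (hn : ‖n‖ = 1) (h : 0 ≤ inner ℝ n v) : -(n i * v i) ≤ k * ‖dropCoord i v‖ := by
  have e : inner ℝ n v = n i * v i + ∑ j : Fin k, n (i.succAbove j) * v (i.succAbove j) := by
    rw [PiLp.inner_apply, Fin.sum_univ_succAbove _ i]
    simp [mul_comm]
  have hb : ∑ j : Fin k, n (i.succAbove j) * v (i.succAbove j)
      ≤ ∑ _j : Fin k, ‖dropCoord i v‖ := by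
    refine Finset.sum_le_sum fun j _ => (le_abs_self _).trans ?_
    rw [abs_mul]
    have h1 : |n (i.succAbove j)| ≤ 1 := by
      rw [← hn]
      exact PiLp.norm_apply_le n _
    exact (mul_le_mul h1 (abs_apply_succAbove_le i v j) (abs_nonneg _) zero_le_one).trans
      (one_mul _).le
  rw [Finset.sum_const, Finset.card_univ, Fintype.card_fin, nsmul_eq_mul] at hb
  linarith

lemma lintegral_volume_slice (i : Fin (k + 1)) {A : Set (EuclideanSpace ℝ (Fin (k + 1)))}
    (hA : MeasurableSet A) :
    ∫⁻ s, volume {w : Fin k → ℝ | insertCoord i s w ∈ A} = volume A := by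
  have h1 : MeasurePreserving (fun q : ℝ × (Fin k → ℝ) => insertCoord i q.1 q.2) :=
    (PiLp.volume_preserving_toLp (Fin (k + 1))).comp
      (volume_preserving_piFinSuccAbove (fun _ : Fin (k + 1) => ℝ) i).symm
  rw [← h1.measure_preimage hA.nullMeasurableSet, Measure.volume_eq_prod,
    Measure.prod_apply (h1.measurable hA)]
  rfl

/-- The boundary of a bounded set with a supporting half-space at each boundary point has finite
codimension one Hausdorff measure. -/
lemma hausdorffMeasure_ne_top_of_supporting {S : Set (EuclideanSpace ℝ (Fin (k + 1)))}
    (hb : Bornology.IsBounded S)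
    (hS : ∀ x ∈ S, ∃ n : EuclideanSpace ℝ (Fin (k + 1)), ‖n‖ = 1 ∧
      ∀ z ∈ S, 0 ≤ inner ℝ n (z - x)) : μH[(k : ℝ)] S ≠ ∞ := by
  obtain ⟨D, hD⟩ := hb.subset_closedBall (0 : EuclideanSpace ℝ (Fin (k + 1)))
  let r : Fin (k + 1) × Bool → EuclideanSpace ℝ (Fin (k + 1)) → (Fin k → ℝ) → Prop :=
    fun i x w => x ∈ S ∧ w = dropCoord i.1 x ∧ ∃ n : EuclideanSpace ℝ (Fin (k + 1)), ‖n‖ = 1 ∧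
      (∀ z ∈ S, 0 ≤ inner ℝ n (z - x)) ∧ 1 ≤ (k + 1) * ((if i.2 then 1 else -1) * n i.1)
  let E : Fin (k + 1) × Bool → Set (EuclideanSpace ℝ (Fin (k + 1))) :=
    fun i => {x | ∃ w ∈ closedBall (0 : Fin k → ℝ) D, r i x w}
  have hcov : S ⊆ ⋃ i, E i := by
    intro x hx
    obtain ⟨n, hn, hnS⟩ := hS x hx
    obtain ⟨i, hi⟩ := exists_norm_le_apply n
    rw [hn] at hi
    have hw : dropCoord i x ∈ closedBall (0 : Fin k → ℝ) D := by
      have hxD : ‖x‖ ≤ D := by simpa using hD hx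
      rw [mem_closedBall_zero_iff]
      refine (pi_norm_le_iff_of_nonneg ((norm_nonneg x).trans hxD)).2 fun j => ?_
      exact (PiLp.norm_apply_le x _).trans hxD
    rcases le_total 0 (n i) with h0 | h0
    · rw [abs_of_nonneg h0] at hi
      exact mem_iUnion.2 ⟨(i, true), dropCoord i x, hw, hx, rfl, n, hn, hnS, by simpa using hi⟩
    · rw [abs_of_nonpos h0] at hi
      exact mem_iUnion.2 ⟨(i, false), dropCoord i x, hw, hx, rfl, n, hn, hnS, by simpa using hi⟩
  have hlip : ∀ i x w x' w', r i x w → r i x' w' →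
      dist x x' ≤ (((k + 1) * k + (k + 1) : ℝ≥0) : ℝ) * dist w w' := by
    rintro ⟨i, σ⟩ x _ x' _ ⟨hx, rfl, n, hn, hnS, hni⟩ ⟨hx', rfl, n', hn', hnS', hni'⟩
    have h1 := neg_mul_apply_le_of_inner_nonneg i hn (hnS x' hx')
    have h2 := neg_mul_apply_le_of_inner_nonneg i hn' (hnS' x hx)
    have hv := norm_le_apply_add_dropCoord i (x - x')
    rw [dropCoord_sub, norm_sub_rev, ← dropCoord_sub, PiLp.sub_apply] at h1
    rw [PiLp.sub_apply] at h2 hv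
    rw [dist_eq_norm, dist_eq_norm, ← dropCoord_sub]
    push_cast
    dsimp only at hni hni'
    set v := ‖dropCoord i (x - x')‖
    set a := x i - x' i
    rw [show x' i - x i = -a by ring] at h1
    have hk : (0 : ℝ) < k + 1 := by positivity
    have hkv : 0 ≤ (k : ℝ) * v := mul_nonneg k.cast_nonneg (norm_nonneg _)
    have aux : ∀ m b : ℝ, 1 ≤ (k + 1) * m → m * b ≤ k * v → b ≤ (k + 1) * (k * v) := by
      intro m b hm hmb
      rcases le_total b 0 with h0 | h0
      · exact h0.trans (by positivity)
      · nlinarith [mul_le_mul_of_nonneg_right hm h0, mul_le_mul_of_nonneg_left hmb hk.le]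
    have habs : |a| ≤ (k + 1) * (k * v) := by
      rw [abs_le']
      cases σ
      · simp only [Bool.false_eq_true, if_false] at hni hni'
        exact ⟨aux _ _ hni' (by linarith), aux _ _ hni (by linarith)⟩
      · simp only [if_true] at hni hni'
        exact ⟨aux _ _ hni (by linarith), aux _ _ hni' (by linarith)⟩
    nlinarith
  have hE : ∀ i, μH[(k : ℝ)] (E i) < ∞ := by
    intro i
    refine (hausdorffMeasure_le_of_relation k.cast_nonneg (r i) (hlip i)
      (fun x hx => hx)).trans_lt ?_
    have hvol : (μH[(k : ℝ)] : Measure (Fin k → ℝ)) = volume := by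
      simpa using hausdorffMeasure_pi_real (ι := Fin k)
    rw [hvol]
    exact ENNReal.mul_lt_top (ENNReal.rpow_lt_top_of_nonneg k.cast_nonneg ENNReal.coe_ne_top)
      (isCompact_closedBall _ _).measure_lt_top
  refine ne_top_of_le_ne_top ?_ ((measure_mono hcov).trans (measure_iUnion_fintype_le _ _))
  exact (ENNReal.sum_lt_top.2 fun i _ => hE i).ne

end Coordinates

section HalfRays

variable {k : ℕ}

local notation "𝔼" => EuclideanSpace ℝ (Fin (k + 1))

/-- The first half of the segment joining `p.1` to `p.2`. -/
def halfSegment {V : Type*} [AddCommGroup V] [Module ℝ V] (p : V × V) : Set V :=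
  (fun t : ℝ => p.1 + t • (p.2 - p.1)) '' Icc 0 (1 / 2)

lemma segment_subset_halfSegment_union {V : Type*} [AddCommGroup V] [Module ℝ V] (p : V × V) :
    segment ℝ p.1 p.2 ⊆ halfSegment p ∪ halfSegment p.swap := by
  rw [segment_eq_image']
  rintro _ ⟨t, ht, rfl⟩
  rcases le_total t (1 / 2) with h | h
  · exact Or.inl ⟨t, ⟨ht.1, h⟩, rfl⟩
  · refine Or.inr ⟨1 - t, ⟨by linarith [ht.2], by linarith⟩, ?_⟩
    simp only [Prod.fst_swap, Prod.snd_swap, sub_smul, smul_sub, one_smul]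
    abel

/-- The parameter at which the segment `p` crosses the hyperplane `{z | z i = s}`. -/
def crossingTime (i : Fin (k + 1)) (q : (𝔼 × 𝔼) × ℝ) : ℝ :=
  (q.2 - q.1.1 i) / (q.1.2 i - q.1.1 i)

/-- The point at which the segment `p` crosses the hyperplane `{z | z i = s}`. -/
def crossing (i : Fin (k + 1)) (q : (𝔼 × 𝔼) × ℝ) : 𝔼 :=
  q.1.1 + crossingTime i q • (q.1.2 - q.1.1)

/-- The pairs `(p, s)` such that the segment `p ∈ Γ` is transverse to the `i`-th direction and its
first half meets `A` in the hyperplane `{z | z i = s}`. -/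
def crossingSet (Γ : Set (𝔼 × 𝔼)) (A : Set 𝔼) (i : Fin (k + 1)) : Set ((𝔼 × 𝔼) × ℝ) :=
  {q | q.1 ∈ Γ ∧ q.1.1 ≠ q.1.2 ∧ ‖q.1.2 - q.1.1‖ ≤ (k + 1) * |q.1.2 i - q.1.1 i| ∧
    crossingTime i q ∈ Icc 0 (1 / 2) ∧ crossing i q ∈ A}

lemma measurable_crossingTime (i : Fin (k + 1)) :
    Measurable (crossingTime i : (𝔼 × 𝔼) × ℝ → ℝ) := by
  unfold crossingTime
  have h : Measurable fun x : 𝔼 => x i := by fun_prop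
  exact (measurable_snd.sub (h.comp (measurable_fst.comp measurable_fst))).div
    ((h.comp (measurable_snd.comp measurable_fst)).sub (h.comp (measurable_fst.comp measurable_fst)))

lemma measurable_crossing (i : Fin (k + 1)) : Measurable (crossing i : (𝔼 × 𝔼) × ℝ → 𝔼) := by
  unfold crossing
  have := measurable_crossingTime (k := k) i
  fun_prop

lemma measurableSet_crossingSet {Γ : Set (𝔼 × 𝔼)} {A : Set 𝔼} (hΓ : MeasurableSet Γ)
    (hA : MeasurableSet A) (i : Fin (k + 1)) : MeasurableSet (crossingSet Γ A i) := by
  have h : Measurable fun x : 𝔼 => x i := by fun_prop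
  refine (measurable_fst hΓ).inter (MeasurableSet.inter ?_ (MeasurableSet.inter ?_
    (MeasurableSet.inter (measurable_crossingTime i measurableSet_Icc) (measurable_crossing i hA))))
  · exact (measurableSet_eq_fun (measurable_fst.comp measurable_fst)
      (measurable_snd.comp measurable_fst)).compl
  · refine measurableSet_le ((measurable_snd.comp measurable_fst).sub
      (measurable_fst.comp measurable_fst)).norm (measurable_const.mul ?_)
    exact ((h.comp (measurable_snd.comp measurable_fst)).sub
      (h.comp (measurable_fst.comp measurable_fst))).abs

lemma apply_ne_of_mem_crossingSet {Γ : Set (𝔼 × 𝔼)} {A : Set 𝔼} {i : Fin (k + 1)}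
    {q : (𝔼 × 𝔼) × ℝ} (hq : q ∈ crossingSet Γ A i) : q.1.2 i - q.1.1 i ≠ 0 := by
  intro h0
  have h := hq.2.2.1
  rw [h0, abs_zero, mul_zero, norm_le_zero_iff, sub_eq_zero] at h
  exact hq.2.1 h.symm

lemma crossing_apply {i : Fin (k + 1)} {q : (𝔼 × 𝔼) × ℝ} (hq : q.1.2 i - q.1.1 i ≠ 0) :
    crossing i q i = q.2 := by
  simp only [crossing, crossingTime, PiLp.add_apply, PiLp.smul_apply, PiLp.sub_apply, smul_eq_mul]
  rw [div_mul_cancel₀ _ hq]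
  ring

/-- The length of the part of a half segment in `A` is controlled by the hyperplane crossings. -/
lemma hausdorffMeasure_halfSegment_inter_le {Γ : Set (𝔼 × 𝔼)} {A : Set 𝔼} {p : 𝔼 × 𝔼}
    (hp : p ∈ Γ) (hne : p.1 ≠ p.2) :
    μH[1] (halfSegment p ∩ A)
      ≤ ((k + 1 : ℝ≥0) : ℝ≥0∞) * ∑ i, volume {s : ℝ | (p, s) ∈ crossingSet Γ A i} := by
  obtain ⟨i, hi⟩ := exists_norm_le_apply (p.2 - p.1)
  rw [PiLp.sub_apply] at hi
  have h0 : p.2 i - p.1 i ≠ 0 := by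
    intro h0
    rw [h0, abs_zero, mul_zero, norm_le_zero_iff, sub_eq_zero] at hi
    exact hne hi.symm
  have hsub : halfSegment p ∩ A
      ⊆ (fun s => crossing i (p, s)) '' {s : ℝ | (p, s) ∈ crossingSet Γ A i} := by
    rintro _ ⟨⟨t, ht, rfl⟩, hA⟩
    have htime : crossingTime i (p, p.1 i + t * (p.2 i - p.1 i)) = t := by
      simp only [crossingTime, add_sub_cancel_left]
      exact mul_div_cancel_right₀ t h0
    have hcross : crossing i (p, p.1 i + t * (p.2 i - p.1 i)) = p.1 + t • (p.2 - p.1) := by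
      rw [crossing, htime]
    refine ⟨p.1 i + t * (p.2 i - p.1 i), ⟨hp, hne, hi, ?_, ?_⟩, hcross⟩
    · rw [htime]; exact ht
    · rw [hcross]; exact hA
  have hlip : LipschitzWith (k + 1) (fun s => crossing i (p, s)) := by
    refine LipschitzWith.of_dist_le_mul fun s s' => ?_
    simp only [dist_eq_norm, crossing, crossingTime, add_sub_add_left_eq_sub, ← sub_smul,
      ← sub_div, sub_sub_sub_cancel_right, norm_smul, norm_div, Real.norm_eq_abs]
    rw [div_mul_eq_mul_div, div_le_iff₀ (abs_pos.2 h0)]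
    push_cast
    nlinarith [mul_le_mul_of_nonneg_left hi (abs_nonneg (s - s'))]
  calc μH[1] (halfSegment p ∩ A)
      ≤ μH[1] ((fun s => crossing i (p, s)) '' {s : ℝ | (p, s) ∈ crossingSet Γ A i}) :=
        measure_mono hsub
    _ ≤ ((k + 1 : ℝ≥0) : ℝ≥0∞) ^ (1 : ℝ) * μH[1] {s : ℝ | (p, s) ∈ crossingSet Γ A i} :=
        hlip.hausdorffMeasure_image_le zero_le_one _
    _ = ((k + 1 : ℝ≥0) : ℝ≥0∞) * volume {s : ℝ | (p, s) ∈ crossingSet Γ A i} := by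
        rw [ENNReal.rpow_one, hausdorffMeasure_real]
    _ ≤ _ := by
        gcongr
        exact Finset.single_le_sum (f := fun i => volume {s : ℝ | (p, s) ∈ crossingSet Γ A i})
          (fun _ _ => zero_le) (Finset.mem_univ i)

/-- If the starting point of the segments of `Γ` is a Lipschitz function of the points of their
first halves, the total length of crossings is controlled by the Lebesgue measure. -/
lemma lintegral_volume_crossingSet_le {γ : Measure (𝔼 × 𝔼)} [IsFiniteMeasure γ]
    {Γ : Set (𝔼 × 𝔼)} {A : Set 𝔼} (hΓ : MeasurableSet Γ) (hA : MeasurableSet A) {L : ℝ≥0}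
    (hL : ∀ p ∈ Γ, ∀ q ∈ Γ, ∀ t ∈ Icc (0 : ℝ) (1 / 2), ∀ t' ∈ Icc (0 : ℝ) (1 / 2),
      ‖p.1 - q.1‖ ≤ L * ‖(p.1 + t • (p.2 - p.1)) - (q.1 + t' • (q.2 - q.1))‖)
    {M : ℝ≥0∞} (hM : ∀ E : Set 𝔼, γ (Prod.fst ⁻¹' E) ≤ M * μH[(k : ℝ)] E) (i : Fin (k + 1)) :
    ∫⁻ p, volume {s : ℝ | (p, s) ∈ crossingSet Γ A i} ∂γ
      ≤ M * ((L * (k + 1) : ℝ≥0) : ℝ≥0∞) ^ (k : ℝ) * volume A := by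
  have hS := measurableSet_crossingSet hΓ hA i
  have hvol : (μH[(k : ℝ)] : Measure (Fin k → ℝ)) = volume := by
    simpa using hausdorffMeasure_pi_real (ι := Fin k)
  have hslice : ∀ s : ℝ, γ {p | (p, s) ∈ crossingSet Γ A i}
      ≤ M * ((L * (k + 1) : ℝ≥0) : ℝ≥0∞) ^ (k : ℝ)
        * volume {w : Fin k → ℝ | insertCoord i s w ∈ A} := by
    intro s
    calc γ {p | (p, s) ∈ crossingSet Γ A i}
        ≤ γ (Prod.fst ⁻¹' (Prod.fst '' {p | (p, s) ∈ crossingSet Γ A i})) :=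
          measure_mono (subset_preimage_image _ _)
      _ ≤ M * μH[(k : ℝ)] (Prod.fst '' {p | (p, s) ∈ crossingSet Γ A i}) := hM _
      _ ≤ M * (((L * (k + 1) : ℝ≥0) : ℝ≥0∞) ^ (k : ℝ)
          * μH[(k : ℝ)] {w : Fin k → ℝ | insertCoord i s w ∈ A}) := by
        gcongr
        refine hausdorffMeasure_le_of_relation k.cast_nonneg
          (fun x w => ∃ p, (p, s) ∈ crossingSet Γ A i ∧ p.1 = x ∧
            w = dropCoord i (crossing i (p, s))) ?_ ?_
        · rintro _ _ _ _ ⟨p, hp, rfl, rfl⟩ ⟨q, hq, rfl, rfl⟩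
          have h1 := hL p hp.1 q hq.1 _ hp.2.2.2.1 _ hq.2.2.2.1
          have h2 := norm_le_apply_add_dropCoord i (crossing i (p, s) - crossing i (q, s))
          rw [PiLp.sub_apply, crossing_apply (apply_ne_of_mem_crossingSet hp),
            crossing_apply (apply_ne_of_mem_crossingSet hq), sub_self, abs_zero, zero_add,
            dropCoord_sub] at h2
          rw [dist_eq_norm, dist_eq_norm]
          push_cast
          rw [mul_assoc]
          exact h1.trans (mul_le_mul_of_nonneg_left h2 L.coe_nonneg)
        · rintro _ ⟨p, hp, rfl⟩
          refine ⟨_, ?_, p, hp, rfl, rfl⟩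
          have h := insertCoord_dropCoord i (crossing i (p, s))
          rw [crossing_apply (apply_ne_of_mem_crossingSet hp)] at h
          rw [mem_ofPred_eq, h]
          exact hp.2.2.2.2
      _ = _ := by rw [hvol, mul_assoc]
  have hmeas : Measurable fun s : ℝ => volume {w : Fin k → ℝ | insertCoord i s w ∈ A} := by
    have h1 : Measurable (fun q : ℝ × (Fin k → ℝ) => insertCoord i q.1 q.2) :=
      (PiLp.volume_preserving_toLp (Fin (k + 1))).measurable.comp
        (MeasurableEquiv.piFinSuccAbove (fun _ : Fin (k + 1) => ℝ) i).symm.measurable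
    exact measurable_measure_prodMk_left (h1 hA)
  calc ∫⁻ p, volume {s : ℝ | (p, s) ∈ crossingSet Γ A i} ∂γ
      = (γ.prod volume) (crossingSet Γ A i) := (Measure.prod_apply hS).symm
    _ = ∫⁻ s, γ {p | (p, s) ∈ crossingSet Γ A i} := Measure.prod_apply_symm hS
    _ ≤ ∫⁻ s, M * ((L * (k + 1) : ℝ≥0) : ℝ≥0∞) ^ (k : ℝ)
        * volume {w : Fin k → ℝ | insertCoord i s w ∈ A} := lintegral_mono hslice
    _ = _ := by rw [lintegral_const_mul _ hmeas, lintegral_volume_slice i hA]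

/-- A measurable upper bound for the length of first halves inside `A`, with controlled integral. -/
lemma exists_measurable_bound_halfSegment {γ : Measure (𝔼 × 𝔼)} [IsFiniteMeasure γ]
    {Γ : Set (𝔼 × 𝔼)} {A : Set 𝔼} (hΓ : MeasurableSet Γ) (hA : MeasurableSet A) {L : ℝ≥0}
    (hL : ∀ p ∈ Γ, ∀ q ∈ Γ, ∀ t ∈ Icc (0 : ℝ) (1 / 2), ∀ t' ∈ Icc (0 : ℝ) (1 / 2),
      ‖p.1 - q.1‖ ≤ L * ‖(p.1 + t • (p.2 - p.1)) - (q.1 + t' • (q.2 - q.1))‖)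
    (hne : ∀ p ∈ Γ, p.1 ≠ p.2)
    {M : ℝ≥0∞} (hM : ∀ E : Set 𝔼, γ (Prod.fst ⁻¹' E) ≤ M * μH[(k : ℝ)] E) :
    ∃ g : 𝔼 × 𝔼 → ℝ≥0∞, Measurable g ∧ (∀ p ∈ Γ, μH[1] (halfSegment p ∩ A) ≤ g p) ∧
      ∫⁻ p, g p ∂γ ≤ ((k + 1 : ℝ≥0) : ℝ≥0∞) * (((k + 1 : ℕ) : ℝ≥0∞)
        * (M * ((L * (k + 1) : ℝ≥0) : ℝ≥0∞) ^ (k : ℝ))) * volume A := by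
  have hmeas : ∀ i, Measurable fun p : 𝔼 × 𝔼 => volume {s : ℝ | (p, s) ∈ crossingSet Γ A i} :=
    fun i => measurable_measure_prodMk_left (measurableSet_crossingSet hΓ hA i)
  refine ⟨fun p => ((k + 1 : ℝ≥0) : ℝ≥0∞) * ∑ i, volume {s : ℝ | (p, s) ∈ crossingSet Γ A i},
    measurable_const.mul (Finset.measurable_sum Finset.univ fun i _ => hmeas i),
    fun p hp => hausdorffMeasure_halfSegment_inter_le hp (hne p hp), ?_⟩
  rw [lintegral_const_mul _ (Finset.measurable_sum Finset.univ fun i _ => hmeas i),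
    lintegral_finsetSum _ fun i _ => hmeas i, mul_assoc]
  gcongr
  refine (Finset.sum_le_sum fun i _ => lintegral_volume_crossingSet_le hΓ hA hL hM i).trans ?_
  rw [Finset.sum_const, Finset.card_univ, Fintype.card_fin, nsmul_eq_mul]
  exact (mul_assoc _ _ _).ge

end HalfRays

section Assembly

lemma msupport_eq_support {α : Type*} [TopologicalSpace α] [MeasurableSpace α] (μ : Measure α) :
    msupport μ = μ.support := by
  ext x
  simp only [msupport, mem_ofPred_eq, Measure.mem_support_iff_forall, pos_iff_ne_zero]

lemma fst_mem_support_map {α β : Type*} [TopologicalSpace α] [TopologicalSpace β]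
    [MeasurableSpace α] [MeasurableSpace β] {γ : Measure (α × β)} {p : α × β}
    (hp : p ∈ γ.support) : p.1 ∈ (γ.map Prod.fst).support := by
  rw [Measure.mem_support_iff_forall] at hp ⊢
  exact fun U hU => (hp _ (continuous_fst.continuousAt.preimage_mem_nhds hU)).trans_le
    (Measure.le_map_apply measurable_fst.aemeasurable U)

lemma snd_mem_support_map {α β : Type*} [TopologicalSpace α] [TopologicalSpace β]
    [MeasurableSpace α] [MeasurableSpace β] {γ : Measure (α × β)} {p : α × β}
    (hp : p ∈ γ.support) : p.2 ∈ (γ.map Prod.snd).support := by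
  rw [Measure.mem_support_iff_forall] at hp ⊢
  exact fun U hU => (hp _ (continuous_snd.continuousAt.preimage_mem_nhds hU)).trans_le
    (Measure.le_map_apply measurable_snd.aemeasurable U)

lemma withDensity_le_smul {α : Type*} [MeasurableSpace α] {μ : Measure α} {h : α → ℝ} {M : ℝ}
    (hM : ∀ x, h x ≤ M) :
    μ.withDensity (fun x => ENNReal.ofReal (h x)) ≤ ENNReal.ofReal M • μ := by
  rw [← withDensity_const]
  exact withDensity_mono (Eventually.of_forall fun x => ENNReal.ofReal_le_ofReal (hM x))

lemma support_subset_of_le_smul_restrict {α : Type*} [TopologicalSpace α] [MeasurableSpace α]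
    [OpensMeasurableSpace α] {μ ν : Measure α} {c : ℝ≥0∞} {S : Set α} (hS : IsClosed S)
    (h : ν ≤ c • μ.restrict S) : ν.support ⊆ S := by
  refine Measure.support_subset_of_isClosed hS ?_
  rw [mem_ae_iff]
  refine le_antisymm ((h _).trans_eq ?_) zero_le
  rw [Measure.smul_apply, Measure.restrict_apply hS.measurableSet.compl]
  simp

/-- Each boundary point of a uniformly convex set has a quantitative inner normal. -/
lemma UniformlyConvexSet.exists_normal {d : ℕ} {Ω : Set (EuclideanSpace ℝ (Fin d))}
    (h : UniformlyConvexSet Ω) : ∃ R > (0 : ℝ), ∀ x ∈ frontier Ω,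
      ∃ n : EuclideanSpace ℝ (Fin d), ‖n‖ = 1 ∧
        ∀ z ∈ frontier Ω, ‖z - x‖ ^ 2 ≤ R * inner ℝ n (z - x) := by
  obtain ⟨-, R, hR, hΩ⟩ := h
  refine ⟨2 * R, by positivity, fun x hx => ?_⟩
  obtain ⟨n, hn, hsub⟩ := hΩ x hx
  refine ⟨n, hn, fun z hz => ?_⟩
  have hz' : z ∈ closedBall (x + R • n) R :=
    closure_minimal (hsub.trans ball_subset_closedBall) isClosed_closedBall
      (frontier_subset_closure hz)
  rw [mem_closedBall, dist_eq_norm, ← sub_sub] at hz'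
  have hsq := pow_le_pow_left₀ (norm_nonneg _) hz' 2
  rw [norm_sub_sq_real, inner_smul_right, norm_smul, hn, mul_one, Real.norm_eq_abs, sq_abs,
    real_inner_comm] at hsq
  linarith

/-- The first marginal of a plan controls the mass of all vertical cylinders, measurable or not. -/
lemma measure_preimage_fst_le {α β : Type*} [MeasurableSpace α] [MeasurableSpace β]
    {γ : Measure (α × β)} {μ : Measure α} {c : ℝ≥0∞} (h : γ.map Prod.fst ≤ c • μ) (E : Set α) :
    γ (Prod.fst ⁻¹' E) ≤ c * μ E :=
  (Measure.le_map_apply measurable_fst.aemeasurable E).trans (h E)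

/-- A plan on the boundary of a domain with quantitative normals, concentrated on a closed set of
long segments which is monotone for the distance cost, has a bounded transport density. -/
lemma exists_transportDensity_le {k : ℕ}
    {γ : Measure (EuclideanSpace ℝ (Fin (k + 1)) × EuclideanSpace ℝ (Fin (k + 1)))}
    [IsFiniteMeasure γ] {S : Set (EuclideanSpace ℝ (Fin (k + 1)))} {δ D R : ℝ} (hδ : 0 < δ)
    (hR : 0 < R)
    (hS : ∀ x ∈ S, ∃ n : EuclideanSpace ℝ (Fin (k + 1)), ‖n‖ = 1 ∧
      ∀ z ∈ S, ‖z - x‖ ^ 2 ≤ R * inner ℝ n (z - x))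
    {M : ℝ≥0∞} (hMtop : M ≠ ∞)
    (h₁ : γ.map Prod.fst ≤ M • μH[(k : ℝ)]) (h₂ : γ.map Prod.snd ≤ M • μH[(k : ℝ)])
    (hsupp : ∀ p ∈ γ.support, p.1 ∈ S ∧ p.2 ∈ S ∧ δ ≤ ‖p.2 - p.1‖ ∧ ‖p.2 - p.1‖ ≤ D)
    (hmono : ∀ p ∈ γ.support, ∀ q ∈ γ.support,
      dist p.1 p.2 + dist q.1 q.2 ≤ dist p.1 q.2 + dist q.1 p.2) :
    ∃ C : ℝ≥0, ∀ A : Set (EuclideanSpace ℝ (Fin (k + 1))), MeasurableSet A →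
      transportDensity γ A ≤ (C : ℝ≥0∞) * volume A := by
  obtain ⟨L, hL⟩ := exists_norm_start_sub_le (V := EuclideanSpace ℝ (Fin (k + 1))) (D := D) hδ hR
  have inner_nonneg : ∀ {n v : EuclideanSpace ℝ (Fin (k + 1))},
      ‖v‖ ^ 2 ≤ R * inner ℝ n v → 0 ≤ inner ℝ n v := by
    intro n v h
    exact nonneg_of_mul_nonneg_right ((sq_nonneg _).trans h) hR
  have lip : ∀ p ∈ γ.support, ∀ q ∈ γ.support, ∀ t ∈ Icc (0 : ℝ) (1 / 2),
      ∀ t' ∈ Icc (0 : ℝ) (1 / 2),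
      ‖p.1 - q.1‖ ≤ L * ‖(p.1 + t • (p.2 - p.1)) - (q.1 + t' • (q.2 - q.1))‖ := by
    intro p hp q hq t ht t' ht'
    obtain ⟨hp1, hp2, hpδ, hpD⟩ := hsupp p hp
    obtain ⟨hq1, hq2, hqδ, hqD⟩ := hsupp q hq
    obtain ⟨n, hn, hnS⟩ := hS _ hp1
    obtain ⟨n', hn', hnS'⟩ := hS _ hq1
    refine hL _ _ _ _ n n' t t' hn hn' hpδ hqδ hpD hqD (hnS _ hp2) (hnS' _ hq2)
      (inner_nonneg (hnS _ hq1)) (inner_nonneg (hnS' _ hp1)) ht.1 ht.2 ht'.1 ht'.2 ?_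
    have h := hmono p hp q hq
    simp only [dist_eq_norm] at h
    rw [norm_sub_rev p.2, norm_sub_rev q.2]
    linarith
  have lip' : ∀ p ∈ Prod.swap ⁻¹' γ.support, ∀ q ∈ Prod.swap ⁻¹' γ.support,
      ∀ t ∈ Icc (0 : ℝ) (1 / 2), ∀ t' ∈ Icc (0 : ℝ) (1 / 2),
      ‖p.1 - q.1‖ ≤ L * ‖(p.1 + t • (p.2 - p.1)) - (q.1 + t' • (q.2 - q.1))‖ := by
    intro p hp q hq t ht t' ht'
    obtain ⟨hp1, hp2, hpδ, hpD⟩ := hsupp p.swap hp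
    obtain ⟨hq1, hq2, hqδ, hqD⟩ := hsupp q.swap hq
    simp only [Prod.fst_swap, Prod.snd_swap] at hp1 hp2 hpδ hpD hq1 hq2 hqδ hqD
    rw [norm_sub_rev] at hpδ hpD hqδ hqD
    obtain ⟨n, hn, hnS⟩ := hS _ hp2
    obtain ⟨n', hn', hnS'⟩ := hS _ hq2
    refine hL _ _ _ _ n n' t t' hn hn' hpδ hqδ hpD hqD (hnS _ hp1) (hnS' _ hq1)
      (inner_nonneg (hnS _ hq2)) (inner_nonneg (hnS' _ hp2)) ht.1 ht.2 ht'.1 ht'.2 ?_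
    have h := hmono p.swap hp q.swap hq
    simp only [dist_eq_norm, Prod.fst_swap, Prod.snd_swap] at h
    rw [norm_sub_rev q.1, norm_sub_rev p.1 q.2]
    linarith
  have ne : ∀ p ∈ γ.support, p.1 ≠ p.2 := by
    intro p hp h
    have := (hsupp p hp).2.2.1
    rw [h, sub_self, norm_zero] at this
    linarith
  have hΓ : MeasurableSet γ.support := Measure.isClosed_support.measurableSet
  have hfin : IsFiniteMeasure (γ.map Prod.swap) := inferInstance
  have h₂' : (γ.map Prod.swap).map Prod.fst ≤ M • μH[(k : ℝ)] := by
    rwa [Measure.map_map measurable_fst measurable_swap]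
  set B : ℝ≥0∞ := ((k + 1 : ℝ≥0) : ℝ≥0∞) * (((k + 1 : ℕ) : ℝ≥0∞)
    * (M * ((L * (k + 1) : ℝ≥0) : ℝ≥0∞) ^ (k : ℝ))) with hB
  have hBtop : B ≠ ∞ := ENNReal.mul_ne_top ENNReal.coe_ne_top
    (ENNReal.mul_ne_top (ENNReal.natCast_ne_top _) (ENNReal.mul_ne_top hMtop
      (ENNReal.rpow_ne_top_of_nonneg k.cast_nonneg ENNReal.coe_ne_top)))
  refine ⟨(B + B).toNNReal, fun A hA => ?_⟩
  rw [ENNReal.coe_toNNReal (ENNReal.add_ne_top.2 ⟨hBtop, hBtop⟩)]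
  obtain ⟨g, hg, hgA, hgB⟩ := exists_measurable_bound_halfSegment hΓ hA lip ne
    (measure_preimage_fst_le h₁)
  obtain ⟨g', hg', hgA', hgB'⟩ := exists_measurable_bound_halfSegment (measurable_swap hΓ) hA lip'
    (fun p hp h => ne p.swap hp h.symm) (measure_preimage_fst_le h₂')
  rw [lintegral_map hg' measurable_swap] at hgB'
  calc transportDensity γ A ≤ ∫⁻ p, (g p + g' p.swap) ∂γ := by
        refine lintegral_mono_ae ?_
        filter_upwards [(Measure.support_mem_ae : γ.support ∈ ae γ)] with p hp
        calc μH[1] (segment ℝ p.1 p.2 ∩ A)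
            ≤ μH[1] ((halfSegment p ∩ A) ∪ (halfSegment p.swap ∩ A)) := by
              rw [← union_inter_distrib_right]
              exact measure_mono (inter_subset_inter_left _ (segment_subset_halfSegment_union p))
          _ ≤ μH[1] (halfSegment p ∩ A) + μH[1] (halfSegment p.swap ∩ A) := measure_union_le _ _
          _ ≤ g p + g' p.swap := add_le_add (hgA p hp) (hgA' p.swap (by simpa using hp))
    _ = (∫⁻ p, g p ∂γ) + ∫⁻ p, g' p.swap ∂γ := lintegral_add_left hg _
    _ ≤ B * volume A + B * volume A := add_le_add hgB hgB'
    _ = (B + B) * volume A := (add_mul _ _ _).symm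

end Assembly

/-- if both `f⁺` and `f⁻` have bounded densities w.r.t. `ℋ^{d-1}|_{∂Ω}` and
disjoint supports, then the transport density is absolutely continuous on `Ω` with bounded
density. -/
theorem stmt2 {d : ℕ} (hd : 2 ≤ d)
    (Ω : Set (EuclideanSpace ℝ (Fin d)))
    (hΩo : IsOpen Ω) (hΩb : Bornology.IsBounded Ω) (hΩuc : UniformlyConvexSet Ω)
    (hp hm : EuclideanSpace ℝ (Fin d) → ℝ)
    (hhpm : Measurable hp) (hhmm : Measurable hm)
    (hhp0 : ∀ x, 0 ≤ hp x) (hhm0 : ∀ x, 0 ≤ hm x)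
    (M : ℝ) (hhpM : ∀ x, hp x ≤ M) (hhmM : ∀ x, hm x ≤ M)
    (fplus fminus : Measure (EuclideanSpace ℝ (Fin d)))
    (hfp : fplus = ((μH[(d : ℝ) - 1]).restrict (frontier Ω)).withDensity
      (fun x => ENNReal.ofReal (hp x)))
    (hfm : fminus = ((μH[(d : ℝ) - 1]).restrict (frontier Ω)).withDensity
      (fun x => ENNReal.ofReal (hm x)))
    (hmass : fplus Set.univ = fminus Set.univ)
    (hdisj : Disjoint (msupport fplus) (msupport fminus))
    (γ : Measure (EuclideanSpace ℝ (Fin d) × EuclideanSpace ℝ (Fin d)))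
    (hγ : IsOptimalPlan fplus fminus γ) :
    ∃ C : ℝ≥0, ∀ A : Set (EuclideanSpace ℝ (Fin d)), MeasurableSet A → A ⊆ Ω →
      transportDensity γ A ≤ (C : ℝ≥0∞) * volume A := by
  obtain ⟨k, rfl⟩ : ∃ k, d = k + 1 := ⟨d - 1, by omega⟩
  rw [show ((k + 1 : ℕ) : ℝ) - 1 = (k : ℝ) by push_cast; ring] at hfp hfm
  set S := frontier Ω with hSdef
  obtain ⟨R, hR, hnormal⟩ := hΩuc.exists_normal
  have hSb : Bornology.IsBounded S := hΩb.closure.subset frontier_subset_closure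
  have hSfin : μH[(k : ℝ)] S ≠ ∞ := by
    refine hausdorffMeasure_ne_top_of_supporting hSb fun x hx => ?_
    obtain ⟨n, hn, hnS⟩ := hnormal x hx
    exact ⟨n, hn, fun z hz => nonneg_of_mul_nonneg_right ((sq_nonneg _).trans (hnS z hz)) hR⟩
  have hple : fplus ≤ ENNReal.ofReal M • (μH[(k : ℝ)]).restrict S :=
    hfp ▸ withDensity_le_smul hhpM
  have hmle : fminus ≤ ENNReal.ofReal M • (μH[(k : ℝ)]).restrict S :=
    hfm ▸ withDensity_le_smul hhmM
  have hγfin : IsFiniteMeasure γ := by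
    refine ⟨?_⟩
    have h : γ univ = fplus univ := by
      rw [← hγ.1.1, Measure.map_apply measurable_fst MeasurableSet.univ, preimage_univ]
    rw [h]
    refine (hple univ).trans_lt ?_
    rw [Measure.smul_apply, Measure.restrict_apply_univ]
    exact ENNReal.mul_lt_top ENNReal.ofReal_lt_top hSfin.lt_top
  have hmem : ∀ p ∈ γ.support, p.1 ∈ S ∧ p.2 ∈ S := fun p hp =>
    ⟨support_subset_of_le_smul_restrict isClosed_frontier hple
        (hγ.1.1 ▸ fst_mem_support_map hp),
      support_subset_of_le_smul_restrict isClosed_frontier hmle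
        (hγ.1.2 ▸ snd_mem_support_map hp)⟩
  have hne : ∀ p ∈ γ.support, p.1 ≠ p.2 := by
    intro p hp h
    rw [msupport_eq_support, msupport_eq_support, ← hγ.1.1, ← hγ.1.2] at hdisj
    exact disjoint_left.1 hdisj (fst_mem_support_map hp) (h ▸ snd_mem_support_map hp)
  have hdiam : ∀ p ∈ γ.support, dist p.1 p.2 ≤ diam S := fun p hp =>
    dist_le_diam_of_mem hSb (hmem p hp).1 (hmem p hp).2
  have hcompact : IsCompact γ.support := by
    have hSc : IsCompact S := isCompact_of_isClosed_isBounded isClosed_frontier hSb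
    exact (hSc.prod hSc).of_isClosed_subset Measure.isClosed_support
      fun p hp => ⟨(hmem p hp).1, (hmem p hp).2⟩
  obtain ⟨δ, hδ, hδle⟩ : ∃ δ > 0, ∀ p ∈ γ.support, δ ≤ dist p.1 p.2 := by
    rcases γ.support.eq_empty_or_nonempty with h | h
    · exact ⟨1, one_pos, by simp [h]⟩
    · obtain ⟨p, hp, hmin⟩ := hcompact.exists_isMinOn h
        (continuous_fst.dist continuous_snd).continuousOn
      exact ⟨dist p.1 p.2, dist_pos.2 (hne p hp), fun q hq => hmin hq⟩
  have hcost : transportCost γ ≠ ∞ := by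
    have hle : transportCost γ ≤ ∫⁻ _, ENNReal.ofReal (diam S) ∂γ := by
      refine lintegral_mono_ae ?_
      filter_upwards [(Measure.support_mem_ae : γ.support ∈ ae γ)] with p hp
      rw [edist_dist]
      exact ENNReal.ofReal_le_ofReal (hdiam p hp)
    refine ne_top_of_le_ne_top ?_ hle
    rw [lintegral_const]
    exact ENNReal.mul_ne_top ENNReal.ofReal_ne_top (measure_ne_top _ _)
  have hrestrict : ENNReal.ofReal M • (μH[(k : ℝ)]).restrict S
      ≤ ENNReal.ofReal M • (μH[(k : ℝ)] : Measure (EuclideanSpace ℝ (Fin (k + 1)))) := by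
    gcongr
    exact Measure.restrict_le_self
  obtain ⟨C, hC⟩ := exists_transportDensity_le (D := diam S) hδ hR hnormal ENNReal.ofReal_ne_top
    (hγ.1.1.trans_le (hple.trans hrestrict)) (hγ.1.2.trans_le (hmle.trans hrestrict))
    (fun p hp => ⟨(hmem p hp).1, (hmem p hp).2, by
      rw [← dist_eq_norm, dist_comm]; exact ⟨hδle p hp, hdiam p hp⟩⟩)
    (fun p hp q hq => hγ.dist_add_dist_le hcost hp hq)
  exact ⟨C, fun A hA _ => hC A hA⟩
end
end
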